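/- Fix x = (x₁, x₂) ∈ ℤ². Then the ratio [∫_{−π}^{π} e^{i t (y₁ − x₁)} · ψ(t)^{|y₂| + |x₂|}/(1 − φ(t)) dt] / [∫_{−π}^{π} e^{i t y₁} · ψ(t)^{|y₂|}/(1 − φ(t)) dt] tends to 1 as |y₁| + |y₂| → ∞ along y = (y₁,y₂) ∈ ℤ². (This ratio equals ∑_{z} ν_x(z) K(z,y), where ν_x is the distribution on the horizontal axis of the simple random walk on ℍ started at x at its first visit to the axis and K is the Martin kernel.) -/

import Mathlib

open Filter Real Complex

noncomputable section

/-- `w(t) = 3 - 2 exp(it)`. -/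
def wFn (t : ℝ) : ℂ := 3 - 2 * Complex.exp (Complex.I * t)

/-- `ψ(t) = w(t) - √(w(t)²-1)` (principal branch of the complex square root). -/
def psiFn (t : ℝ) : ℂ := wFn t - (wFn t ^ 2 - 1) ^ ((1 : ℂ) / 2)

/-- `φ(t) = Re(w(t)·ψ(t))`. -/
def phiFn (t : ℝ) : ℝ := (wFn t * psiFn t).re


/-! ### The square roots -/

def Uf (z : ℂ) : ℂ := (1 - z) ^ (2⁻¹ : ℂ)
def Vf (z : ℂ) : ℂ := (√2 : ℝ) * Uf (z / 2)
def Sf (z : ℂ) : ℂ := Vf z - Uf z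

lemma Uf_sq (z : ℂ) : Uf z ^ 2 = 1 - z := by
  unfold Uf; exact Complex.cpow_ofNat_inv_pow _ 2

lemma Vf_sq (z : ℂ) : Vf z ^ 2 = 2 - z := by
  unfold Vf
  rw [mul_pow, Uf_sq, ← Complex.ofReal_pow, Real.sq_sqrt (by norm_num)]
  push_cast; ring

lemma Uf_re_nonneg (z : ℂ) : 0 ≤ (Uf z).re := by
  unfold Uf; rw [Complex.cpow_inv_two_re]; positivity

lemma Vf_re_nonneg (z : ℂ) : 0 ≤ (Vf z).re := by
  unfold Vf; rw [Complex.re_ofReal_mul]; exact mul_nonneg (by positivity) (Uf_re_nonneg _)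

lemma Uf_re_im (z : ℂ) : (Uf z).re ^ 2 - (Uf z).im ^ 2 = 1 - z.re := by
  have := congrArg Complex.re (Uf_sq z)
  simp [pow_two] at this ⊢; linarith

lemma Vf_re_im (z : ℂ) : (Vf z).re ^ 2 - (Vf z).im ^ 2 = 2 - z.re := by
  have := congrArg Complex.re (Vf_sq z)
  simp [pow_two] at this ⊢; linarith

lemma Uf_norm_sq (z : ℂ) : ‖Uf z‖ ^ 2 = ‖1 - z‖ := by
  rw [← norm_pow, Uf_sq]

lemma Uf_re_lower {z : ℂ} (hz : z.re ≤ 1) : ‖1 - z‖ / 2 ≤ (Uf z).re ^ 2 := by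
  have h1 := Uf_re_im z
  have h2 : (Uf z).re ^ 2 + (Uf z).im ^ 2 = ‖1 - z‖ := by
    rw [← Uf_norm_sq, ← Complex.normSq_eq_norm_sq, Complex.normSq_apply]; ring
  linarith

lemma Vf_re_lower {z : ℂ} (hz : z.re ≤ 1) : 1 ≤ (Vf z).re := by
  have h1 := Vf_re_im z
  have h2 := Vf_re_nonneg z
  nlinarith [sq_nonneg (Vf z).im]

lemma UV_re_pos {z : ℂ} (hz : z.re ≤ 1) (hz1 : z ≠ 1) : 0 < (Uf z * Vf z).re := by
  have h1 := Uf_re_im z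
  have h2 := Vf_re_im z
  have h3 := Uf_re_nonneg z
  have h4 := Vf_re_lower hz
  have h5 := Uf_re_lower hz
  have h6 : 0 < ‖1 - z‖ := norm_pos_iff.2 (sub_ne_zero.2 (Ne.symm hz1))
  have h7 : 0 < (Uf z).re := by
    rcases h3.eq_or_lt with h | h
    · rw [← h] at h5; norm_num at h5; linarith
    · exact h
  have a1 : |(Uf z).im| ≤ (Uf z).re := by
    apply abs_le_of_sq_le_sq _ h3; linarith
  have a2 : |(Vf z).im| < (Vf z).re := by
    apply abs_lt_of_sq_lt_sq _ (by linarith); linarith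
  rw [Complex.mul_re]
  have : (Uf z).im * (Vf z).im ≤ |(Uf z).im| * |(Vf z).im| := by
    rw [← abs_mul]; exact le_abs_self _
  have : |(Uf z).im| * |(Vf z).im| ≤ (Uf z).re * |(Vf z).im| := by gcongr
  have : (Uf z).re * |(Vf z).im| < (Uf z).re * (Vf z).re := by gcongr
  linarith

lemma Uf_one : Uf 1 = 0 := by simp [Uf]

lemma sqrt_formula {z : ℂ} (hz : z.re ≤ 1) :
    ((3 - 2 * z) ^ 2 - 1) ^ ((1 : ℂ) / 2) = 2 * (Uf z * Vf z) := by
  by_cases h : z = 1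
  · subst h
    rw [Uf_one]
    have : ((3 - 2 * 1 : ℂ) ^ 2 - 1) = 0 := by norm_num
    rw [this, Complex.zero_cpow (by norm_num)]; simp
  · have h1 := UV_re_pos hz h
    have h2 : 0 < (2 * (Uf z * Vf z)).re := by
      have : (2 * (Uf z * Vf z)).re = 2 * (Uf z * Vf z).re := by
        simp
      rw [this]; linarith
    have h3 : ((3 - 2 * z) ^ 2 - 1) = (2 * (Uf z * Vf z)) ^ 2 := by
      rw [mul_pow, mul_pow, Uf_sq, Vf_sq]; ring
    rw [h3, one_div]
    exact Complex.sq_cpow_two_inv h2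

def ee (t : ℝ) : ℂ := Complex.exp (Complex.I * t)

lemma ee_norm (t : ℝ) : ‖ee t‖ = 1 := by
  unfold ee; rw [mul_comm]; exact Complex.norm_exp_ofReal_mul_I t

lemma ee_re_le (t : ℝ) : (ee t).re ≤ 1 := (Complex.re_le_norm _).trans (ee_norm t).le

lemma psi_eq (t : ℝ) : psiFn t = Sf (ee t) ^ 2 := by
  unfold psiFn wFn
  change (3 - 2 * ee t) - ((3 - 2 * ee t) ^ 2 - 1) ^ ((1 : ℂ) / 2) = _
  rw [sqrt_formula (ee_re_le t), Sf]
  linear_combination -Uf_sq (ee t) - Vf_sq (ee t)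

lemma Sf_mul (z : ℂ) : Sf z * (Vf z + Uf z) = 1 := by
  unfold Sf; linear_combination Vf_sq z - Uf_sq z

lemma Sf_norm_le {z : ℂ} (hz : z.re ≤ 1) : ‖Sf z‖ * (1 + √(‖1 - z‖ / 2)) ≤ 1 := by
  have h1 : 1 + √(‖1 - z‖ / 2) ≤ ‖Vf z + Uf z‖ := by
    refine le_trans ?_ (Complex.re_le_norm _)
    rw [Complex.add_re]
    have := Real.sqrt_le_sqrt (Uf_re_lower hz)
    rw [Real.sqrt_sq (Uf_re_nonneg z)] at this
    linarith [Vf_re_lower hz]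
  have h2 := congrArg norm (Sf_mul z)
  rw [norm_mul, norm_one] at h2
  calc _ ≤ ‖Sf z‖ * ‖Vf z + Uf z‖ := by gcongr
    _ = 1 := h2

lemma Sf_norm_le_one {z : ℂ} (hz : z.re ≤ 1) : ‖Sf z‖ ≤ 1 := by
  have := Sf_norm_le hz
  nlinarith [norm_nonneg (Sf z), Real.sqrt_nonneg (‖1 - z‖ / 2)]

lemma Uf_ne {z : ℂ} (h : z ≠ 1) : Uf z ≠ 0 := by
  intro h0
  have := Uf_sq z
  rw [h0] at this
  apply h; linear_combination this

lemma Uf_conj {z : ℂ} (hz : z.re ≤ 1) : Uf (star z) = star (Uf z) := by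
  unfold Uf
  have := Complex.cpow_conj (1 - z) (2⁻¹) (by
    intro h
    have := Complex.arg_eq_pi_iff.1 h
    simp at this; linarith)
  have h2 : (starRingEnd ℂ) (2⁻¹ : ℂ) = 2⁻¹ := by
    rw [map_inv₀, show (2:ℂ) = ((2:ℝ):ℂ) by norm_num, Complex.conj_ofReal]
  rw [h2] at this
  rw [this]; simp

lemma Vf_conj {z : ℂ} (hz : z.re ≤ 1) : Vf (star z) = star (Vf z) := by
  unfold Vf
  have : star z / 2 = star (z / 2) := by simp
  rw [this, Uf_conj]
  · simp
  · have : (z / 2).re = z.re / 2 := by simp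
    rw [this]; linarith

lemma ee_neg (t : ℝ) : ee (-t) = star (ee t) := by
  unfold ee
  change _ = (starRingEnd ℂ) _
  rw [← Complex.exp_conj]; simp

/-! ### Power series -/

def bet : ℕ → ℝ
  | 0 => 1
  | (n + 1) => bet n * (2 * n + 1) / (2 * n + 2)

lemma choose_step (a : ℂ) (n : ℕ) :
    Ring.choose a (n + 1) * (n + 1) = Ring.choose a n * (a - n) := by
  have h1 := Ring.descPochhammer_eq_factorial_smul_choose a (n+1)
  have h2 := Ring.descPochhammer_eq_factorial_smul_choose a n
  rw [descPochhammer_succ_right, Polynomial.smeval_mul, h2] at h1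
  simp [Polynomial.smeval_sub, Polynomial.smeval_natCast, Nat.factorial_succ] at h1
  have h3 : ((n.factorial : ℕ) : ℂ) ≠ 0 := by exact_mod_cast n.factorial_ne_zero
  apply mul_left_cancel₀ h3
  linear_combination -h1

lemma bet_eq (n : ℕ) : Ring.choose (-2⁻¹ : ℂ) n * (-1) ^ n = bet n := by
  induction n with
  | zero => simp [bet]
  | succ n ih =>
    have := choose_step (-2⁻¹) n
    have h1 : ((n : ℂ) + 1) ≠ 0 := by exact_mod_cast n.succ_ne_zero
    have h2 : (2 * (n : ℂ) + 2) ≠ 0 := by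
      have : (2 * (n : ℂ) + 2) = 2 * (n + 1) := by ring
      rw [this]; exact mul_ne_zero (by norm_num) h1
    simp only [bet]; push_cast
    rw [← ih, eq_div_iff h2]
    rw [pow_succ]
    linear_combination (-1)^n * (-2) * this

lemma bet_pos (n : ℕ) : 0 < bet n := by
  induction n with
  | zero => simp [bet]
  | succ n ih => simp only [bet]; positivity

lemma bet_succ_le (n : ℕ) : bet (n + 1) ≤ bet n := by
  simp only [bet]
  rw [div_le_iff₀ (by positivity)]
  have := bet_pos n
  nlinarith

lemma bet_sq (n : ℕ) : 1 / 4 ≤ bet (n + 1) ^ 2 * (n + 1) := by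
  induction n with
  | zero => simp [bet]; norm_num
  | succ n ih =>
    refine ih.trans ?_
    rw [show bet (n + 1 + 1) = bet (n + 1) * (2 * (n + 1 : ℕ) + 1) / (2 * (n + 1 : ℕ) + 2) from rfl]
    rw [div_pow, mul_pow]
    rw [div_mul_eq_mul_div, le_div_iff₀ (by positivity), mul_assoc, mul_assoc]
    push_cast
    have : 0 ≤ bet (n + 1) ^ 2 := sq_nonneg _
    apply mul_le_mul_of_nonneg_left _ this
    have : (0 : ℝ) ≤ n := n.cast_nonneg
    nlinarith

lemma bet_lower (n : ℕ) : 1 / (2 * √((n : ℝ) + 1)) ≤ bet n := by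
  rw [div_le_iff₀ (by positivity)]
  have hp := bet_pos n
  have h1 : 1 / 4 ≤ bet n ^ 2 * (n + 1) := by
    cases n with
    | zero => simp [bet]; norm_num
    | succ n =>
      refine (bet_sq n).trans ?_
      gcongr; linarith
  have h2 : (1/2 : ℝ) ≤ bet n * √(n + 1) := by
    apply le_of_sq_le_sq _ (by positivity)
    rw [mul_pow, Real.sq_sqrt (by positivity)]; linarith
  linarith

lemma bet_hasSum {z : ℂ} (hz : ‖z‖ < 1) : HasSum (fun n => (bet n : ℂ) * z ^ n) (Uf z)⁻¹ := by
  have h := Complex.one_add_cpow_hasFPowerSeriesOnBall_zero (a := -2⁻¹)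
  have h2 := h.hasSum (y := -z) (by
    simp only [Metric.mem_eball, edist_zero_right, enorm_neg]
    rw [← ofReal_norm, ← ENNReal.ofReal_one]
    exact (ENNReal.ofReal_lt_ofReal_iff one_pos).2 hz)
  simp only [zero_add, binomialSeries_apply] at h2
  have e1 : (1 + -z) ^ (-2⁻¹ : ℂ) = (Uf z)⁻¹ := by
    rw [Complex.cpow_neg, Uf, sub_eq_add_neg]
  rw [e1] at h2
  have e2 : (fun n => (bet n : ℂ) * z ^ n) =
      fun n => Ring.choose (-2⁻¹ : ℂ) n • (List.ofFn fun _ : Fin n => -z).prod := by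
    funext n
    simp only [List.ofFn_const, List.prod_replicate, smul_eq_mul]
    rw [← bet_eq, neg_pow z]; ring
  rw [e2]; exact h2


def HasPos (F : ℂ → ℂ) (a : ℕ → ℝ) : Prop :=
  (∀ n, 0 ≤ a n) ∧ ∀ z : ℂ, ‖z‖ < 1 → HasSum (fun n => (a n : ℂ) * z ^ n) (F z)

lemma HasPos.summable_norm {F a} (h : HasPos F a) {z : ℂ} (hz : ‖z‖ < 1) :
    Summable (fun n => ‖(a n : ℂ) * z ^ n‖) := by
  have := (h.2 (‖z‖ : ℂ) (by simpa using hz)).summable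
  rw [← summable_norm_iff] at this
  convert this using 2 with n
  simp

lemma HasPos.mul {F G a b} (hF : HasPos F a) (hG : HasPos G b) :
    HasPos (fun z => F z * G z)
      (fun n => ∑ kl ∈ Finset.HasAntidiagonal.antidiagonal n, a kl.1 * b kl.2) := by
  refine ⟨fun n => Finset.sum_nonneg fun kl _ => mul_nonneg (hF.1 _) (hG.1 _), fun z hz => ?_⟩
  have h1 := hF.summable_norm hz
  have h2 := hG.summable_norm hz
  have h3 := summable_norm_sum_mul_antidiagonal_of_summable_norm h1 h2
  have h4 := tsum_mul_tsum_eq_tsum_sum_antidiagonal_of_summable_norm h1 h2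
  rw [(hF.2 z hz).tsum_eq, (hG.2 z hz).tsum_eq] at h4
  change HasSum _ (F z * G z)
  rw [h4]
  refine h3.of_norm.hasSum.congr_fun ?_
  intro n
  push_cast
  rw [Finset.sum_mul]
  refine Finset.sum_congr rfl fun kl hkl => ?_
  rw [← Finset.HasAntidiagonal.mem_antidiagonal.1 hkl, pow_add]; ring

lemma HasPos.pow {F a} (hF : HasPos F a) (k : ℕ) : ∃ b, HasPos (fun z => F z ^ k) b := by
  induction k with
  | zero =>
    refine ⟨fun n => if n = 0 then 1 else 0, fun n => by dsimp only; split_ifs <;> norm_num, fun z hz => ?_⟩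
    convert hasSum_ite_eq 0 (1 : ℂ) using 2 with n
    · split_ifs with h <;> simp [h]
    · simp
  | succ k ih =>
    obtain ⟨b, hb⟩ := ih
    exact ⟨_, by simpa only [pow_succ] using hb.mul hF⟩

lemma bet_hasPos : HasPos (fun z => (Uf z)⁻¹) bet := ⟨fun n => (bet_pos n).le, fun _ => bet_hasSum⟩

def dd : ℕ → ℝ
  | 0 => 1
  | (n + 1) => bet (n + 1) - bet n

lemma Uf_hasSum {z : ℂ} (hz : ‖z‖ < 1) : HasSum (fun n => (dd n : ℂ) * z ^ n) (Uf z) := by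
  have hz1 : z ≠ 1 := by rintro rfl; simp at hz
  have h := bet_hasSum hz
  have h1 := (hasSum_nat_add_iff' 1).2 h
  have h2 := h1.sub (h.mul_left z)
  rw [← hasSum_nat_add_iff' 1]
  convert h2 using 1
  · funext n
    simp only [dd]; push_cast; ring
  · simp [dd, bet]
    field_simp [Uf_ne hz1]
    linear_combination Uf_sq z

def ss (n : ℕ) : ℝ := dd n * (√2 / 2 ^ n - 1)

lemma Sf_hasPos : HasPos Sf ss := by
  constructor
  · intro n
    cases n with
    | zero =>
      simp [ss, dd]
    | succ n =>
      simp only [ss, dd]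
      apply mul_nonneg_of_nonpos_of_nonpos
      · linarith [bet_succ_le n]
      · rw [sub_nonpos, div_le_one (by positivity), pow_succ]
        have : √2 ≤ 2 := by rw [Real.sqrt_le_left (by norm_num)]; norm_num
        have : (1 : ℝ) ≤ 2 ^ n := one_le_pow₀ (by norm_num)
        linarith
  · intro z hz
    have h1 := Uf_hasSum hz
    have h2 := (Uf_hasSum (z := z / 2) (by
      rw [norm_div]; simp; linarith [norm_nonneg z])).mul_left ((√2 : ℝ) : ℂ)
    have h3 := h2.sub h1
    change HasSum _ (Vf z - Uf z)
    refine h3.congr_fun ?_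
    intro n
    simp only [ss]; push_cast; rw [div_pow]
    ring


open MeasureTheory in
lemma hasSum_int (f : ℕ → ℝ → ℂ) (F : ℝ → ℂ) (b : ℕ → ℝ) (hf : ∀ n, Continuous (f n))
    (hb : Summable b) (hfb : ∀ n t, ‖f n t‖ ≤ b n) (h : ∀ t, HasSum (fun n => f n t) (F t)) :
    HasSum (fun n => ∫ t in (-Real.pi)..Real.pi, f n t) (∫ t in (-Real.pi)..Real.pi, F t) := by
  apply intervalIntegral.hasSum_integral_of_dominated_convergence (fun n _ => b n)
  · exact fun n => (hf n).aestronglyMeasurable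
  · exact fun n => ae_of_all _ fun t _ => hfb n t
  · exact ae_of_all _ fun t _ => hb
  · exact intervalIntegrable_const
  · exact ae_of_all _ fun t _ => h t

lemma int_mode (m : ℤ) : ∫ t in (-Real.pi)..Real.pi, Complex.exp (Complex.I * t * (m : ℂ)) =
    ((if m = 0 then 2 * π else 0 : ℝ) : ℂ) := by
  split_ifs with h
  · subst h; simp; ring
  · have hc : Complex.I * (m : ℂ) ≠ 0 := mul_ne_zero Complex.I_ne_zero (by exact_mod_cast h)
    have : ∀ t : ℝ, Complex.exp (Complex.I * t * (m : ℂ)) = Complex.exp ((Complex.I * m) * t) :=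
      fun t => by congr 1; ring
    simp_rw [this]
    rw [integral_exp_mul_complex hc]
    have h2 : Complex.exp (Complex.I * m * (π : ℝ)) = Complex.exp (Complex.I * m * ((-π : ℝ) : ℂ)) := by
      rw [Complex.exp_eq_exp_iff_exists_int]
      exact ⟨m, by push_cast; ring⟩
    rw [h2]; simp

lemma mode_norm (t : ℝ) (m : ℂ) (hm : m.im = 0) : ‖Complex.exp (Complex.I * t * m)‖ = 1 := by
  rw [Complex.norm_exp]; simp [hm]

lemma ee_pow (t : ℝ) (l : ℕ) : ee t ^ l = Complex.exp (Complex.I * t * (l : ℂ)) := by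
  unfold ee; rw [← Complex.exp_nat_mul]; congr 1; ring

lemma ee_cont : Continuous ee := by unfold ee; fun_prop

lemma J_exists {r : ℝ} (hr0 : 0 ≤ r) (hr1 : r < 1) (m : ℤ) : ∃ J : ℝ,
    ∫ t in (-Real.pi)..Real.pi, Complex.exp (Complex.I * t * (m : ℂ)) *
      ((Uf (r * ee t))⁻¹.re : ℂ) = (J : ℂ) ∧ π * bet m.natAbs * r ^ m.natAbs ≤ J := by
  have hz : ∀ t, ‖(r : ℂ) * ee t‖ < 1 := fun t => by
    rw [norm_mul, ee_norm]; simpa [abs_of_nonneg hr0] using hr1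
  have hbs : Summable (fun n => bet n * r ^ n) := by
    have := bet_hasPos.summable_norm (z := r) (by simpa [abs_of_nonneg hr0] using hr1)
    convert this using 2 with n
    simp [abs_of_nonneg hr0, abs_of_nonneg (bet_pos n).le]
  have key := hasSum_int
    (fun l t => ((bet l * r ^ l / 2 : ℝ) : ℂ) * (Complex.exp (Complex.I * t * ((m + l : ℤ) : ℂ)) +
      Complex.exp (Complex.I * t * ((m - l : ℤ) : ℂ))))
    (fun t => Complex.exp (Complex.I * t * (m : ℂ)) * ((Uf (r * ee t))⁻¹.re : ℂ))
    (fun n => bet n * r ^ n) (fun n => by fun_prop) hbs ?_ ?_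
  · have key2 : ∀ l : ℕ, (∫ t in (-Real.pi)..Real.pi, ((bet l * r ^ l / 2 : ℝ) : ℂ) *
        (Complex.exp (Complex.I * t * ((m + l : ℤ) : ℂ)) +
        Complex.exp (Complex.I * t * ((m - l : ℤ) : ℂ)))) =
        ((bet l * r ^ l / 2 * ((if m + l = 0 then 2 * π else 0) +
          (if m - l = 0 then 2 * π else 0)) : ℝ) : ℂ) := by
      intro l
      rw [intervalIntegral.integral_const_mul, intervalIntegral.integral_add, int_mode, int_mode]
      · push_cast; rfl
      · apply Continuous.intervalIntegrable; fun_prop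
      · apply Continuous.intervalIntegrable; fun_prop
    simp_rw [key2] at key
    have hre := Complex.hasSum_re key
    simp only [Complex.ofReal_re] at hre
    have him := Complex.hasSum_im key
    simp only [Complex.ofReal_im] at him
    have him0 := him.unique hasSum_zero
    refine ⟨_, (Complex.ext (by rw [Complex.ofReal_re]) (by rw [him0, Complex.ofReal_im])), ?_⟩
    refine le_trans ?_ (le_hasSum hre m.natAbs ?_)
    · have hb := bet_pos m.natAbs
      have hp := Real.pi_pos
      have hrp : 0 ≤ r ^ m.natAbs := by positivity
      have : 2 * π ≤ ((if m + m.natAbs = 0 then 2 * π else 0) +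
          (if m - m.natAbs = 0 then 2 * π else 0)) := by
        rcases le_total 0 m with h | h
        · rw [if_pos (show m - (m.natAbs : ℤ) = 0 by omega)]
          split_ifs <;> linarith
        · rw [if_pos (show m + (m.natAbs : ℤ) = 0 by omega)]
          split_ifs <;> linarith
      calc π * bet m.natAbs * r ^ m.natAbs = bet m.natAbs * r ^ m.natAbs / 2 * (2 * π) := by ring
        _ ≤ _ := by gcongr
    · intro j _
      have hb := bet_pos j
      have hp := Real.pi_pos
      apply mul_nonneg (by positivity)
      split_ifs <;> linarith
  · intro n t
    rw [norm_mul]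
    have h1 : ‖((bet n * r ^ n / 2 : ℝ) : ℂ)‖ = bet n * r ^ n / 2 := by
      rw [Complex.norm_real, Real.norm_of_nonneg]
      have := bet_pos n
      positivity
    rw [h1]
    have h2 := norm_add_le (Complex.exp (Complex.I * t * ((m + n : ℤ) : ℂ)))
      (Complex.exp (Complex.I * t * ((m - n : ℤ) : ℂ)))
    rw [mode_norm _ _ (by simp), mode_norm _ _ (by simp)] at h2
    have := bet_pos n
    calc _ ≤ bet n * r ^ n / 2 * (1 + 1) := by gcongr
      _ = _ := by ring
  · intro t
    have h1 := bet_hasSum (hz t)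
    have h2 := Complex.hasSum_conj'.2 h1
    have h3 := ((h1.add h2).mul_left (Complex.exp (Complex.I * t * (m : ℂ)) / 2))
    have e1 : Complex.exp (Complex.I * t * (m : ℂ)) / 2 * ((Uf (r * ee t))⁻¹ +
        (starRingEnd ℂ) (Uf (r * ee t))⁻¹) =
        Complex.exp (Complex.I * t * (m : ℂ)) * ((Uf (r * ee t))⁻¹.re : ℂ) := by
      rw [Complex.add_conj]; push_cast; ring
    rw [e1] at h3
    refine h3.congr_fun fun l => ?_
    have e2 : Complex.exp (Complex.I * t * ((m + l : ℤ) : ℂ)) =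
        Complex.exp (Complex.I * t * (m : ℂ)) * ee t ^ l := by
      rw [ee_pow, ← Complex.exp_add]; congr 1; push_cast; ring
    have e3 : Complex.exp (Complex.I * t * ((m - l : ℤ) : ℂ)) =
        Complex.exp (Complex.I * t * (m : ℂ)) * (starRingEnd ℂ) (ee t ^ l) := by
      rw [ee_pow, ← Complex.exp_conj, ← Complex.exp_add]; congr 1; push_cast; simp; ring
    rw [e2, e3]
    simp only [map_mul, map_pow, Complex.conj_ofReal]
    push_cast
    ring

lemma Uf_real {ρ : ℝ} (h : ρ < 1) : Uf ρ = (√(1 - ρ) : ℝ) := by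
  unfold Uf
  have : (1 - (ρ : ℂ)) = ((√(1 - ρ) : ℝ) : ℂ) ^ 2 := by
    rw [← Complex.ofReal_pow, Real.sq_sqrt (by linarith)]; push_cast; ring
  rw [this]
  exact Complex.sq_cpow_two_inv (by rw [Complex.ofReal_re]; exact Real.sqrt_pos.2 (by linarith))

lemma Sf_real {ρ : ℝ} (h : ρ < 1) : ∃ s : ℝ, Sf ρ = s ∧ 1 - √(1 - ρ) ≤ s := by
  refine ⟨√2 * √(1 - ρ / 2) - √(1 - ρ), ?_, ?_⟩
  · unfold Sf Vf
    rw [Uf_real h]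
    have : (ρ : ℂ) / 2 = ((ρ / 2 : ℝ) : ℂ) := by push_cast; rfl
    rw [this, Uf_real (by linarith)]
    push_cast; rfl
  · rw [← Real.sqrt_mul (by norm_num)]
    have : 1 ≤ √(2 * (1 - ρ / 2)) := by
      rw [Real.one_le_sqrt]; linarith
    linarith

lemma Uf_contAt {z : ℂ} (h : z.re < 1) : ContinuousAt Uf z := by
  unfold Uf
  refine ContinuousAt.cpow (by fun_prop) (by fun_prop) ?_
  left; simpa using h

lemma Vf_contAt {z : ℂ} (h : z.re ≤ 1) : ContinuousAt Vf z := by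
  unfold Vf
  apply ContinuousAt.mul (by fun_prop)
  refine ContinuousAt.comp (f := fun z : ℂ => z / 2) (g := Uf) (Uf_contAt ?_) (by fun_prop)
  have : (z / 2).re = z.re / 2 := by simp
  rw [this]; linarith

lemma Sf_contAt {z : ℂ} (h : z.re < 1) : ContinuousAt Sf z :=
  (Vf_contAt h.le).sub (Uf_contAt h)

lemma ree_re_lt {r : ℝ} (hr0 : 0 ≤ r) (hr1 : r < 1) (t : ℝ) : ((r : ℂ) * ee t).re < 1 := by
  rw [Complex.re_ofReal_mul]
  nlinarith [ee_re_le t]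

lemma exp_bound {x L : ℝ} (hx : 0 < x) (hL : 0 < L) : Real.exp (-(x / L)) / √L ≤ 1 / √x := by
  rw [div_le_div_iff₀ (by positivity) (by positivity), one_mul]
  apply le_of_sq_le_sq _ (by positivity)
  rw [mul_pow, Real.sq_sqrt hx.le, Real.sq_sqrt hL.le, ← Real.exp_nat_mul]
  have h1 := Real.add_one_le_exp (x / L)
  have h0 : 0 < x / L := by positivity
  have h2 : Real.exp (((2 : ℕ) : ℝ) * -(x / L)) * Real.exp (x / L) ≤ 1 := by
    rw [← Real.exp_add]; apply Real.exp_le_one_iff.2; push_cast; linarith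
  have h3 : x = x / L * L := by field_simp
  have h4 : Real.exp (((2 : ℕ) : ℝ) * -(x / L)) * (x / L) ≤ 1 := by
    refine le_trans ?_ h2
    gcongr; linarith
  calc _ = Real.exp (((2 : ℕ) : ℝ) * -(x / L)) * (x / L) * L := by rw [mul_assoc, ← h3]
    _ ≤ 1 * L := by gcongr
    _ = L := one_mul L

lemma Mr_lower {r : ℝ} (hr0 : 0 ≤ r) (hr1 : r < 1) (n : ℤ) (k : ℕ) {L : ℝ} (hL : 0 < L) :
    π / 2 * (Real.exp (-((n.natAbs + 1) / L)) / √L) * r ^ n.natAbs *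
      (1 - √(1 - r ^ 2 * Real.exp (-(1 / L)))) ^ (2 * k) ≤
    ‖∫ t in (-Real.pi)..Real.pi, Complex.exp (Complex.I * t * (n : ℂ)) *
      Sf (r * ee t) ^ (2 * k) * ((Uf (r * ee t))⁻¹.re : ℂ)‖ := by
  have hz : ∀ t, ‖(r : ℂ) * ee t‖ < 1 := fun t => by
    rw [norm_mul, ee_norm]; simpa [abs_of_nonneg hr0] using hr1
  obtain ⟨p, hp⟩ := Sf_hasPos.pow (2 * k)
  choose J hJ1 hJ2 using J_exists hr0 hr1
  have hps : Summable (fun n => p n * r ^ n) := by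
    have := hp.summable_norm (z := r) (by simpa [abs_of_nonneg hr0] using hr1)
    convert this using 2 with n
    simp [abs_of_nonneg hr0, abs_of_nonneg (hp.1 n)]
  have hQc : Continuous (fun t => (((Uf (r * ee t))⁻¹.re : ℝ) : ℂ)) := by
    apply Complex.continuous_ofReal.comp
    apply Complex.continuous_re.comp
    apply Continuous.inv₀
    · rw [continuous_iff_continuousAt]
      intro t
      exact ContinuousAt.comp (f := fun t => (r : ℂ) * ee t) (g := Uf)
        (Uf_contAt (ree_re_lt hr0 hr1 t)) (continuous_const.mul ee_cont).continuousAt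
    · intro t
      apply Uf_ne
      intro h
      have := hz t
      rw [h] at this; simp at this
  have hQb : ∀ t, ‖(((Uf (r * ee t))⁻¹.re : ℝ) : ℂ)‖ ≤ ∑' n, bet n * r ^ n := by
    intro t
    rw [Complex.norm_real]
    refine (Complex.abs_re_le_norm _).trans ?_
    rw [← (bet_hasSum (hz t)).tsum_eq]
    refine (norm_tsum_le_tsum_norm (bet_hasPos.summable_norm (hz t))).trans_eq ?_
    congr 1; funext n
    simp [ee_norm, abs_of_nonneg hr0, abs_of_nonneg (bet_pos n).le]
  have key := hasSum_int
    (fun j t => ((p j * r ^ j : ℝ) : ℂ) * (Complex.exp (Complex.I * t * ((n + j : ℤ) : ℂ)) *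
      ((Uf (r * ee t))⁻¹.re : ℂ)))
    (fun t => Complex.exp (Complex.I * t * (n : ℂ)) *
      Sf (r * ee t) ^ (2 * k) * ((Uf (r * ee t))⁻¹.re : ℂ))
    (fun j => p j * r ^ j * ∑' n, bet n * r ^ n) (fun n => by fun_prop) (hps.mul_right _) ?_ ?_
  · simp_rw [intervalIntegral.integral_const_mul, hJ1, ← Complex.ofReal_mul] at key
    have hre := Complex.hasSum_re key
    simp only [Complex.ofReal_re] at hre
    refine le_trans ?_ (Complex.re_le_norm _)
    set ρ : ℝ := r ^ 2 * Real.exp (-(1 / L)) with hρ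
    have hρ0 : 0 ≤ ρ := by positivity
    have hρ1 : ρ < 1 := by
      have : Real.exp (-(1 / L)) ≤ 1 := by
        apply Real.exp_le_one_iff.2
        have : 0 < 1 / L := by positivity
        linarith
      calc ρ ≤ r ^ 2 * 1 := by rw [hρ]; gcongr
        _ < 1 := by nlinarith
    obtain ⟨s, hs1, hs2⟩ := Sf_real hρ1
    have hsum := hp.2 ρ (by simpa [abs_of_nonneg hρ0] using hρ1)
    simp only [hs1] at hsum
    have hsum2 : HasSum (fun j => p j * ρ ^ j) (s ^ (2 * k)) := by
      exact_mod_cast hsum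
    have h1 : 0 ≤ 1 - √(1 - ρ) := by
      rw [sub_nonneg, Real.sqrt_le_left zero_le_one]; linarith
    set A := π / 2 * (Real.exp (-((n.natAbs + 1) / L)) / √L) * r ^ n.natAbs with hA
    have hA0 : 0 ≤ A := by positivity
    calc A * (1 - √(1 - ρ)) ^ (2 * k) ≤ A * s ^ (2 * k) := by gcongr
      _ ≤ _ := ?_
    refine hasSum_le ?_ (hsum2.mul_left A) hre
    intro j
    have hj := hJ2 (n + j)
    have hx : (0 : ℝ) < n.natAbs + j + 1 := by positivity
    have hle : (n + (j : ℤ)).natAbs ≤ n.natAbs + j := by omega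
    have hleR : (((n + (j : ℤ)).natAbs : ℕ) : ℝ) ≤ n.natAbs + j := by exact_mod_cast hle
    have b1 : Real.exp (-((n.natAbs + j + 1 : ℝ) / L)) / √L ≤ 2 * bet (n + (j : ℤ)).natAbs := by
      refine (exp_bound hx hL).trans ?_
      have h2 := bet_lower (n + (j : ℤ)).natAbs
      have h3 : 1 / √(n.natAbs + j + 1 : ℝ) ≤ 1 / √(((n + (j : ℤ)).natAbs : ℝ) + 1) := by
        gcongr
      have h4 : 1 / √(((n + (j : ℤ)).natAbs : ℝ) + 1) =
          2 * (1 / (2 * √(((n + (j : ℤ)).natAbs : ℝ) + 1))) := by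
        field_simp
      linarith
    have b2 : r ^ (n.natAbs + j) ≤ r ^ (n + (j : ℤ)).natAbs := pow_le_pow_of_le_one hr0 hr1.le hle
    have b3 : Real.exp (-((n.natAbs + j + 1 : ℝ) / L)) =
        Real.exp (-((n.natAbs + 1) / L)) * Real.exp (-(1 / L)) ^ j := by
      rw [← Real.exp_nat_mul, ← Real.exp_add]; congr 1; field_simp; ring
    have hpj := hp.1 j
    calc A * (p j * ρ ^ j) = p j * r ^ j * (π / 2 * (Real.exp (-((n.natAbs + j + 1 : ℝ) / L)) / √L) *
          r ^ (n.natAbs + j)) := by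
          rw [b3, hA, hρ, mul_pow, ← pow_mul, pow_add]; ring
      _ ≤ p j * r ^ j * (π / 2 * (2 * bet (n + (j : ℤ)).natAbs) * r ^ (n + (j : ℤ)).natAbs) := by
          gcongr
          have := bet_pos (n + (j : ℤ)).natAbs
          positivity
      _ = p j * r ^ j * (π * bet (n + (j : ℤ)).natAbs * r ^ (n + (j : ℤ)).natAbs) := by ring
      _ ≤ p j * r ^ j * J (n + j) := by gcongr
  · intro j t
    rw [norm_mul, norm_mul, mode_norm _ _ (by simp), one_mul, Complex.norm_real,
      Real.norm_of_nonneg (mul_nonneg (hp.1 j) (by positivity))]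
    have := hp.1 j
    gcongr
    exact hQb t
  · intro t
    have h1 := (hp.2 _ (hz t)).mul_left
      (Complex.exp (Complex.I * t * (n : ℂ)) * ((Uf (r * ee t))⁻¹.re : ℂ))
    have e1 : Complex.exp (Complex.I * t * (n : ℂ)) * ((Uf (r * ee t))⁻¹.re : ℂ) *
        (fun z => Sf z ^ (2 * k)) (r * ee t) = Complex.exp (Complex.I * t * (n : ℂ)) *
      Sf (r * ee t) ^ (2 * k) * ((Uf (r * ee t))⁻¹.re : ℂ) := by ring
    rw [e1] at h1
    refine h1.congr_fun fun j => ?_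
    have e2 : Complex.exp (Complex.I * t * ((n + j : ℤ) : ℂ)) =
        Complex.exp (Complex.I * t * (n : ℂ)) * ee t ^ j := by
      rw [ee_pow, ← Complex.exp_add]; congr 1; push_cast; ring
    rw [e2]; push_cast; ring


lemma norm_one_sub_ee (t : ℝ) : ‖1 - ee t‖ = 2 * |Real.sin (t / 2)| := by
  rw [norm_sub_rev]; unfold ee
  rw [Complex.norm_exp_I_mul_ofReal_sub_one, norm_mul]; simp

lemma norm_one_sub_ee_lower {t : ℝ} (h : |t| ≤ π) : 2 / π * |t| ≤ ‖1 - ee t‖ := by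
  rw [norm_one_sub_ee]
  have h1 : |Real.sin (t / 2)| = |Real.sin (|t| / 2)| := by
    rcases abs_cases t with ⟨h, _⟩ | ⟨h, _⟩ <;> rw [h]
    rw [neg_div, Real.sin_neg, abs_neg]
  rw [h1]
  have h2 := Real.mul_le_sin (x := |t| / 2) (by positivity) (by linarith)
  have h3 := le_abs_self (Real.sin (|t| / 2))
  have : 2 / π * |t| = 2 * (2 / π * (|t| / 2)) := by ring
  linarith

lemma ee_ne_one {t : ℝ} (h : |t| ≤ π) (h0 : t ≠ 0) : ee t ≠ 1 := by
  intro h1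
  have := norm_one_sub_ee_lower h
  rw [h1] at this
  simp at this
  have h2 : 0 < 2 / π * |t| := mul_pos (by positivity) (abs_pos.2 h0)
  linarith

lemma ee_re_lt {t : ℝ} (h : |t| ≤ π) (h0 : t ≠ 0) : (ee t).re < 1 := by
  rcases (ee_re_le t).lt_or_eq with h1 | h1
  · exact h1
  · exfalso
    apply ee_ne_one h h0
    have h2 : (ee t).re ^ 2 + (ee t).im ^ 2 = 1 := by
      have := Complex.normSq_eq_norm_sq (ee t)
      rw [Complex.normSq_apply, ee_norm] at this; linarith
    rw [h1] at h2
    have : (ee t).im = 0 := by nlinarith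
    exact Complex.ext (by simpa using h1) (by simpa using this)

lemma Uf_inv_bound {t r : ℝ} (h : |t| ≤ π) (h0 : t ≠ 0) (hr0 : 0 ≤ r) (hr1 : r ≤ 1) :
    ‖(Uf (r * ee t))⁻¹‖ ≤ √π * (√|t|)⁻¹ := by
  have h1 := norm_one_sub_ee_lower h
  have h2 : ‖1 - ee t‖ ≤ 2 * ‖1 - r * ee t‖ := by
    have a1 : ‖1 - ee t‖ ≤ ‖1 - r * ee t‖ + (1 - r) := by
      have : 1 - ee t = (1 - r * ee t) - ((1 - r : ℝ) : ℂ) * ee t := by push_cast; ring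
      rw [this]
      refine (norm_sub_le _ _).trans ?_
      rw [norm_mul, ee_norm, Complex.norm_real, Real.norm_of_nonneg (by linarith)]; simp
    have a2 : 1 - r ≤ ‖1 - r * ee t‖ := by
      have := norm_sub_norm_le (1 : ℂ) (r * ee t)
      rw [norm_mul, ee_norm, Complex.norm_real, Real.norm_of_nonneg hr0] at this
      simpa using this
    linarith
  have ht : 0 < |t| := abs_pos.2 h0
  have h3 : |t| / π ≤ ‖Uf (r * ee t)‖ ^ 2 := by
    rw [Uf_norm_sq]
    have : 2 / π * |t| = 2 * (|t| / π) := by ring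
    linarith
  have h4 := Real.sqrt_le_sqrt h3
  rw [Real.sqrt_sq (norm_nonneg _), Real.sqrt_div ht.le] at h4
  have h5 : 0 < √|t| / √π := by positivity
  rw [norm_inv]
  calc ‖Uf (r * ee t)‖⁻¹ ≤ (√|t| / √π)⁻¹ := by gcongr
    _ = _ := by rw [inv_div]; rfl

open MeasureTheory in
lemma inv_sqrt_int_pos : IntervalIntegrable (fun t : ℝ => (√t)⁻¹) volume 0 π := by
  have := intervalIntegral.intervalIntegrable_rpow' (a := 0) (b := π) (r := -(1/2)) (by norm_num)
  refine this.congr ?_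
  intro t ht
  rw [Set.uIoc_of_le Real.pi_pos.le] at ht
  simp only [Real.sqrt_eq_rpow]
  rw [Real.rpow_neg ht.1.le]

open MeasureTheory in
lemma inv_sqrt_abs_int : IntervalIntegrable (fun t : ℝ => (√|t|)⁻¹) volume (-π) π := by
  have h1 : IntervalIntegrable (fun t : ℝ => (√|t|)⁻¹) volume 0 π := by
    refine inv_sqrt_int_pos.congr ?_
    intro t ht
    rw [Set.uIoc_of_le Real.pi_pos.le] at ht
    simp only [abs_of_pos ht.1]
  have h2 := (IntervalIntegrable.iff_comp_neg).1 h1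
  simp only [abs_neg, neg_zero] at h2
  exact h2.symm.trans h1

lemma Uf_meas : Measurable Uf := by unfold Uf; fun_prop
lemma Vf_meas : Measurable Vf := by
  unfold Vf; exact measurable_const.mul (Uf_meas.comp (by fun_prop))
lemma Sf_meas : Measurable Sf := Vf_meas.sub Uf_meas

lemma mode_cont (n : ℂ) : Continuous (fun t : ℝ => Complex.exp (Complex.I * t * n)) := by fun_prop

/-- The main term. -/
def MM (n : ℤ) (k : ℕ) : ℂ := ∫ t in (-Real.pi)..Real.pi, Complex.exp (Complex.I * t * (n : ℂ)) *
      Sf (ee t) ^ (2 * k) * ((Uf (ee t))⁻¹.re : ℂ)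

lemma abs_le_of_uIoc {t : ℝ} (ht : t ∈ Set.uIoc (-π) π) : |t| ≤ π := by
  rw [Set.uIoc_of_le (by linarith [Real.pi_pos])] at ht
  exact abs_le.2 ⟨ht.1.le, ht.2⟩

open MeasureTheory Topology in
lemma MM_tendsto (n : ℤ) (k : ℕ) : Tendsto (fun r : ℝ => ∫ t in (-Real.pi)..Real.pi,
      Complex.exp (Complex.I * t * (n : ℂ)) *
      Sf (r * ee t) ^ (2 * k) * ((Uf (r * ee t))⁻¹.re : ℂ)) (𝓝[<] 1) (𝓝 (MM n k)) := by
  have hev : ∀ᶠ r : ℝ in 𝓝[<] 1, 0 ≤ r ∧ r ≤ 1 := by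
    filter_upwards [Ioo_mem_nhdsLT (show (0:ℝ) < 1 by norm_num)] with r hr
    exact ⟨hr.1.le, hr.2.le⟩
  have hne : ∀ᵐ t : ℝ ∂volume, t ≠ 0 := by simp [ae_iff]
  apply intervalIntegral.tendsto_integral_filter_of_dominated_convergence
    (fun t => √π * (√|t|)⁻¹)
  · refine Eventually.of_forall fun r => Measurable.aestronglyMeasurable ?_
    have e := ee_cont.measurable
    have h1 : Measurable fun t => Sf (r * ee t) := Sf_meas.comp (measurable_const.mul e)
    have h2 : Measurable fun t => Uf (r * ee t) := Uf_meas.comp (measurable_const.mul e)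
    exact ((mode_cont n).measurable.mul (h1.pow_const _)).mul
      (Complex.measurable_ofReal.comp (Complex.measurable_re.comp h2.inv))
  · filter_upwards [hev] with r hr
    filter_upwards [hne] with t ht0 ht
    have h := abs_le_of_uIoc ht
    rw [norm_mul, norm_mul, mode_norm _ _ (by simp), one_mul, norm_pow, Complex.norm_real]
    have h1 : ‖Sf (r * ee t)‖ ≤ 1 := Sf_norm_le_one (by
      rw [Complex.re_ofReal_mul]
      nlinarith [ee_re_le t])
    calc _ ≤ 1 * ‖(Uf (r * ee t))⁻¹‖ := by
          gcongr
          · exact pow_le_one₀ (norm_nonneg _) h1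
          · exact Complex.abs_re_le_norm _
      _ ≤ _ := by rw [one_mul]; exact Uf_inv_bound h ht0 hr.1 hr.2
  · exact inv_sqrt_abs_int.const_mul _
  · filter_upwards [hne] with t ht0 ht
    have h := abs_le_of_uIoc ht
    have hre := ee_re_lt h ht0
    have hlim : Tendsto (fun r : ℝ => (r : ℂ) * ee t) (𝓝[<] 1) (𝓝 (ee t)) := by
      have : Tendsto (fun r : ℝ => (r : ℂ) * ee t) (𝓝 1) (𝓝 (((1 : ℝ) : ℂ) * ee t)) :=
        Continuous.tendsto (by fun_prop) 1
      rw [Complex.ofReal_one, one_mul] at this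
      exact this.mono_left nhdsWithin_le_nhds
    have hU := (Uf_contAt hre).tendsto.comp hlim
    have hS := (Sf_contAt hre).tendsto.comp hlim
    have hUi := hU.inv₀ (Uf_ne (ee_ne_one h ht0))
    exact (tendsto_const_nhds.mul (hS.pow _)).mul
      ((Complex.continuous_ofReal.comp Complex.continuous_re).continuousAt.tendsto.comp hUi)

open Topology in
lemma MM_lower (n : ℤ) (k : ℕ) :
    1 / 100 / √((k : ℝ) ^ 2 + 1 + n.natAbs) ≤ ‖MM n k‖ := by
  set D : ℝ := (k : ℝ) ^ 2 + 1 + n.natAbs with hD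
  have hD0 : 0 < D := by positivity
  set L : ℝ := 16 * D with hL
  have hL0 : 0 < L := by positivity
  have h1 : π / 2 * (Real.exp (-((n.natAbs + 1) / L)) / √L) * 1 ^ n.natAbs *
      (1 - √(1 - 1 ^ 2 * Real.exp (-(1 / L)))) ^ (2 * k) ≤ ‖MM n k‖ := by
    refine le_of_tendsto_of_tendsto (f := fun r : ℝ =>
      π / 2 * (Real.exp (-((n.natAbs + 1) / L)) / √L) * r ^ n.natAbs *
      (1 - √(1 - r ^ 2 * Real.exp (-(1 / L)))) ^ (2 * k)) (b := 𝓝[<] 1) ?_ (MM_tendsto n k).norm ?_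
    · refine Tendsto.mono_left ?_ nhdsWithin_le_nhds
      exact Continuous.tendsto (by fun_prop) 1
    · filter_upwards [Ioo_mem_nhdsLT (show (0:ℝ) < 1 by norm_num)] with r hr
      exact Mr_lower hr.1.le hr.2 n k hL0
  refine le_trans ?_ h1
  have hsL : √L = 4 * √D := by
    rw [hL, Real.sqrt_mul (by norm_num), show (16 : ℝ) = 4 ^ 2 by norm_num, Real.sqrt_sq (by norm_num)]
  have hk : (k : ℝ) ≤ √D := by
    apply Real.le_sqrt_of_sq_le; rw [hD]
    have : (0 : ℝ) ≤ n.natAbs := by positivity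
    linarith
  have hsD : 0 < √D := Real.sqrt_pos.2 hD0
  have h2 : √(1 - 1 ^ 2 * Real.exp (-(1 / L))) ≤ 1 / √L := by
    rw [show 1 / √L = √(1 / L) by rw [one_div, one_div, Real.sqrt_inv]]
    apply Real.sqrt_le_sqrt
    have := Real.add_one_le_exp (-(1 / L))
    rw [one_pow, one_mul]
    linarith
  have h3 : (1 : ℝ) / 2 ≤ (1 - 1 / √L) ^ (2 * k) := by
    have hb : 1 / √L ≤ 1 := by
      rw [hsL, div_le_one (by positivity)]
      have : 1 ≤ √D := by
        rw [Real.one_le_sqrt, hD]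
        have : (0 : ℝ) ≤ n.natAbs := by positivity
        nlinarith [sq_nonneg (k : ℝ)]
      linarith
    have := one_add_mul_le_pow (a := -(1 / √L)) (by linarith) (2 * k)
    rw [← sub_eq_add_neg] at this
    refine le_trans ?_ this
    have h4 : (k : ℝ) * (1 / √L) ≤ 1 / 4 := by
      rw [hsL, mul_one_div, div_le_div_iff₀ (by positivity) (by norm_num)]; linarith
    push_cast; linarith
  have hb1 : 0 ≤ 1 - 1 / √L := by
    rw [sub_nonneg, hsL, div_le_one (by positivity)]
    have : 1 ≤ √D := by
      rw [Real.one_le_sqrt, hD]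
      have : (0 : ℝ) ≤ n.natAbs := by positivity
      nlinarith [sq_nonneg (k : ℝ)]
    linarith
  have h5 : (1 : ℝ) / 2 ≤ (1 - √(1 - 1 ^ 2 * Real.exp (-(1 / L)))) ^ (2 * k) := by
    refine h3.trans ?_
    gcongr
  have h6 : (1 : ℝ) / 2 ≤ Real.exp (-((n.natAbs + 1) / L)) := by
    have := Real.add_one_le_exp (-(((n.natAbs : ℝ) + 1) / L))
    have h7 : ((n.natAbs : ℝ) + 1) / L ≤ 1 / 2 := by
      rw [div_le_div_iff₀ hL0 (by norm_num), hL, hD]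
      nlinarith [sq_nonneg (k : ℝ), (Nat.cast_nonneg n.natAbs : (0 : ℝ) ≤ n.natAbs)]
    linarith
  rw [one_pow, mul_one, hsL]
  have hpi := Real.pi_gt_three
  calc 1 / 100 / √D ≤ 3 / 2 * (1 / 2 / (4 * √D)) * (1 / 2) := by
        rw [div_div, show (3 : ℝ) / 2 * (1 / 2 / (4 * √D)) * (1 / 2) = 3 / 32 / √D by
          field_simp; norm_num, ← div_div]
        gcongr <;> norm_num
    _ ≤ π / 2 * (Real.exp (-((n.natAbs + 1) / L)) / (4 * √D)) *
        (1 - √(1 - 1 ^ 2 * Real.exp (-(1 / L)))) ^ (2 * k) := by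
        gcongr


def Nice (f : ℝ → ℂ) : Prop := ∃ C : ℝ, 0 ≤ C ∧ ∀ t : ℝ, 0 < t → t ≤ π →
  ∃ d : ℂ, HasDerivAt f d t ∧ ‖f t‖ ≤ C ∧ ‖d‖ ≤ C * (√t)⁻¹

lemma one_le_isq {t : ℝ} (h0 : 0 < t) (h : t ≤ π) : 1 ≤ √π * (√t)⁻¹ := by
  rw [← div_eq_mul_inv, one_le_div (Real.sqrt_pos.2 h0)]
  exact Real.sqrt_le_sqrt h

lemma Nice.of_bdd {f : ℝ → ℂ} {f' : ℝ → ℂ} (C : ℝ) (h : ∀ t, HasDerivAt f (f' t) t)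
    (h1 : ∀ t, ‖f t‖ ≤ C) (h2 : ∀ t, ‖f' t‖ ≤ C) : Nice f := by
  have hC : 0 ≤ C := (norm_nonneg _).trans (h1 0)
  refine ⟨C * (1 + √π), by positivity, fun t h0 ht => ⟨f' t, h t, ?_, ?_⟩⟩
  · refine (h1 t).trans ?_
    nlinarith [Real.sqrt_nonneg π]
  · have := one_le_isq h0 ht
    have h3 : 0 ≤ (√t)⁻¹ := by positivity
    refine (h2 t).trans ?_
    rw [mul_assoc]
    nlinarith

lemma Nice.const (c : ℂ) : Nice (fun _ => c) :=
  Nice.of_bdd (f' := fun _ => 0) ‖c‖ (fun t => hasDerivAt_const t c) (fun _ => le_rfl) (by simp)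

lemma Nice.add {f g : ℝ → ℂ} (hf : Nice f) (hg : Nice g) : Nice (fun t => f t + g t) := by
  obtain ⟨C, hC, hf⟩ := hf
  obtain ⟨D, hD, hg⟩ := hg
  refine ⟨C + D, by positivity, fun t h0 ht => ?_⟩
  obtain ⟨d, a1, a2, a3⟩ := hf t h0 ht
  obtain ⟨e, b1, b2, b3⟩ := hg t h0 ht
  refine ⟨d + e, a1.add b1, (norm_add_le _ _).trans (by linarith),
    (norm_add_le _ _).trans (by rw [add_mul]; linarith)⟩

lemma Nice.mul {f g : ℝ → ℂ} (hf : Nice f) (hg : Nice g) : Nice (fun t => f t * g t) := by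
  obtain ⟨C, hC, hf⟩ := hf
  obtain ⟨D, hD, hg⟩ := hg
  refine ⟨2 * (C * D), by positivity, fun t h0 ht => ?_⟩
  obtain ⟨d, a1, a2, a3⟩ := hf t h0 ht
  obtain ⟨e, b1, b2, b3⟩ := hg t h0 ht
  refine ⟨_, a1.mul b1, ?_, ?_⟩
  · rw [norm_mul]
    have : ‖f t‖ * ‖g t‖ ≤ C * D := by gcongr
    have : 0 ≤ C * D := by positivity
    linarith
  · refine (norm_add_le _ _).trans ?_
    rw [norm_mul, norm_mul]
    have h1 : ‖d‖ * ‖g t‖ ≤ C * (√t)⁻¹ * D := by gcongr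
    have h2 : ‖f t‖ * ‖e‖ ≤ C * (D * (√t)⁻¹) := by gcongr
    linarith

lemma Nice.neg {f : ℝ → ℂ} (hf : Nice f) : Nice (fun t => - f t) := by
  have := (Nice.const (-1)).mul hf
  simpa using this

lemma Nice.sub {f g : ℝ → ℂ} (hf : Nice f) (hg : Nice g) : Nice (fun t => f t - g t) := by
  have := hf.add hg.neg
  simpa [sub_eq_add_neg] using this

lemma Nice.pow {f : ℝ → ℂ} (hf : Nice f) (n : ℕ) : Nice (fun t => f t ^ n) := by
  induction n with
  | zero => simpa using Nice.const 1
  | succ n ih => simpa [pow_succ] using ih.mul hf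

lemma Nice.star {f : ℝ → ℂ} (hf : Nice f) : Nice (fun t => star (f t)) := by
  obtain ⟨C, hC, hf⟩ := hf
  refine ⟨C, hC, fun t h0 ht => ?_⟩
  obtain ⟨d, a1, a2, a3⟩ := hf t h0 ht
  exact ⟨Star.star d, a1.star, by rwa [norm_star], by rwa [norm_star]⟩

lemma Nice.inv {f : ℝ → ℂ} (hf : Nice f) {c : ℝ} (hc : 0 < c)
    (h : ∀ t, 0 < t → t ≤ π → c ≤ ‖f t‖) : Nice (fun t => (f t)⁻¹) := by
  obtain ⟨C, hC, hf⟩ := hf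
  refine ⟨c⁻¹ + C * (c ^ 2)⁻¹, by positivity, fun t h0 ht => ?_⟩
  obtain ⟨d, a1, a2, a3⟩ := hf t h0 ht
  have hh := h t h0 ht
  have hne : f t ≠ 0 := norm_pos_iff.1 (hc.trans_le hh)
  have hp : 0 < ‖f t‖ := norm_pos_iff.2 hne
  refine ⟨_, a1.fun_inv hne, ?_, ?_⟩
  · rw [norm_inv]
    have : ‖f t‖⁻¹ ≤ c⁻¹ := by gcongr
    have : 0 ≤ C * (c ^ 2)⁻¹ := by positivity
    linarith
  · rw [norm_div, norm_neg, norm_pow, div_eq_mul_inv]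
    have h1 : ‖d‖ * (‖f t‖ ^ 2)⁻¹ ≤ C * (√t)⁻¹ * (c ^ 2)⁻¹ := by gcongr
    have : 0 ≤ c⁻¹ * (√t)⁻¹ := by positivity
    rw [add_mul]; linarith

lemma ee_deriv (t : ℝ) : HasDerivAt ee (I * ee t) t := by
  unfold ee
  have h : HasDerivAt (fun t : ℝ => I * (t : ℂ)) I t := by
    simpa using (Complex.ofRealCLM.hasDerivAt (x := t)).const_mul I
  simpa [mul_comm] using h.cexp

def ex (t : ℝ) : ℂ := Complex.exp (I * ((t - π) / 4 : ℝ))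

lemma ex_deriv (t : ℝ) : HasDerivAt ex (I / 4 * ex t) t := by
  have h : HasDerivAt (fun t : ℝ => I * ((((t - π) / 4 : ℝ)) : ℂ)) (I / 4) t := by
    have h1 : HasDerivAt (fun t : ℝ => (t - π) / 4) (1 / 4) t :=
      ((hasDerivAt_id t).sub_const π).div_const 4
    simpa [mul_one_div, div_eq_mul_inv] using (h1.ofReal_comp).const_mul I
  have h2 := h.cexp
  rw [mul_comm] at h2
  exact h2

lemma ex_norm (t : ℝ) : ‖ex t‖ = 1 := by
  unfold ex; rw [mul_comm]; exact Complex.norm_exp_ofReal_mul_I _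

lemma ee_nice : Nice ee :=
  Nice.of_bdd 1 ee_deriv (fun t => (ee_norm t).le) (fun t => by simp [ee_norm])

lemma ex_nice : Nice ex :=
  Nice.of_bdd 1 ex_deriv (fun t => (ex_norm t).le) (fun t => by simp [ex_norm]; norm_num)

def uu (t : ℝ) : ℂ := Uf (ee t)
def vv (t : ℝ) : ℂ := Vf (ee t)

lemma Uf_deriv {z : ℂ} (h : z.re < 1) : HasDerivAt Uf (-(2 * Uf z)⁻¹) z := by
  have h1 : HasDerivAt (fun z : ℂ => 1 - z) (-1) z := by
    simpa using (hasDerivAt_id z).const_sub 1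
  have h2 := h1.cpow_const (c := 2⁻¹) (by left; simpa using h)
  have hne : (1 - z) ≠ 0 := by
    intro h0
    have := congrArg Complex.re h0
    simp at this; linarith
  unfold Uf
  convert h2 using 1
  rw [show (2⁻¹ - 1 : ℂ) = - 2⁻¹ by norm_num, Complex.cpow_neg, mul_inv]; ring

lemma uu_nice : Nice uu := by
  refine ⟨√2 + √π, by positivity, fun t h0 ht => ?_⟩
  have hab : |t| ≤ π := by rwa [abs_of_pos h0]
  have hd := (Uf_deriv (ee_re_lt hab h0.ne')).comp t (ee_deriv t)
  refine ⟨_, hd, ?_, ?_⟩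
  · have : ‖uu t‖ ≤ √2 := by
      apply Real.le_sqrt_of_sq_le
      unfold uu; rw [Uf_norm_sq]
      refine (norm_sub_le _ _).trans ?_
      rw [ee_norm]; norm_num
    linarith [Real.sqrt_nonneg π]
  · have h1 := Uf_inv_bound hab h0.ne' zero_le_one le_rfl
    rw [abs_of_pos h0] at h1
    simp only [ofReal_one, one_mul] at h1
    rw [norm_mul, norm_mul, ee_norm, norm_neg, mul_inv, norm_mul]
    simp only [norm_inv, Complex.norm_I, Complex.norm_ofNat] at h1 ⊢
    have : 0 ≤ √2 * (√t)⁻¹ := by positivity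
    have : 0 ≤ ‖Uf (ee t)‖⁻¹ := by positivity
    rw [add_mul]; linarith

lemma vv_norm_lower (t : ℝ) : 1 ≤ ‖vv t‖ := 
  (Vf_re_lower (ee_re_le t)).trans (Complex.re_le_norm _)

lemma vv_nice : Nice vv := by
  refine Nice.of_bdd (f' := fun t => -(2 * vv t)⁻¹ * (I * ee t)) (√3) (fun t => ?_) (fun t => ?_) (fun t => ?_)
  · have h2 : HasDerivAt (fun z : ℂ => z / 2) (1 / 2) (ee t) := (hasDerivAt_id _).div_const 2
    have h3 := ((Uf_deriv (z := ee t / 2) (by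
      have := ee_re_le t
      simp; linarith)).comp (ee t) h2).comp t (ee_deriv t)
    have h4 := h3.const_mul ((√2 : ℝ) : ℂ)
    refine HasDerivAt.congr_deriv (f := vv) h4 ?_
    unfold vv Vf
    have : (((√2 : ℝ) : ℂ))⁻¹ = ((√2 : ℝ) : ℂ) / 2 := by
      have : ((√2 : ℝ) : ℂ) ^ 2 = 2 := by
        rw [← Complex.ofReal_pow, Real.sq_sqrt (by norm_num)]; norm_num
      have h0 : ((√2 : ℝ) : ℂ) ≠ 0 := by intro h; rw [h] at this; norm_num at this
      field_simp; exact this.symm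
    rw [mul_inv, mul_inv, mul_inv, this]; ring
  · apply Real.le_sqrt_of_sq_le
    rw [← norm_pow]; unfold vv; rw [Vf_sq]
    refine (norm_sub_le _ _).trans ?_
    rw [ee_norm]; norm_num
  · have h1 : 1 ≤ √3 := by rw [Real.one_le_sqrt]; norm_num
    have h2 : ‖vv t‖⁻¹ ≤ 1 := inv_le_one_of_one_le₀ (vv_norm_lower t)
    simp [ee_norm]
    linarith


lemma ex_star (t : ℝ) : ex t * star (ex t) = 1 := by
  have := Complex.mul_conj (ex t)
  rw [Complex.normSq_eq_norm_sq, ex_norm] at this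
  simpa using this

lemma ee_star (t : ℝ) : ee t * star (ee t) = 1 := by
  have := Complex.mul_conj (ee t)
  rw [Complex.normSq_eq_norm_sq, ee_norm] at this
  simpa using this

def xc (t : ℝ) : ℂ := uu t * star (ex t)

lemma xc_nice : Nice xc := uu_nice.mul ex_nice.star

lemma xc_real {t : ℝ} (h0 : 0 < t) (ht : t ≤ π) : ∃ x : ℝ, 0 < x ∧ xc t = x := by
  have hs : 0 < Real.sin (t / 2) := Real.sin_pos_of_pos_of_lt_pi (by linarith) (by linarith)
  refine ⟨√(2 * Real.sin (t / 2)), by positivity, ?_⟩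
  set x := √(2 * Real.sin (t / 2)) with hx
  have hxp : 0 < x := by positivity
  have hx2 : (x : ℂ) ^ 2 = 2 * Complex.sin (t / 2) := by
    rw [← Complex.ofReal_pow, hx, Real.sq_sqrt (by positivity)]; push_cast; rfl
  have h1 : 1 - ee t = (x * ex t) ^ 2 := by
    rw [mul_pow, hx2]
    unfold ex ee
    rw [← Complex.exp_nat_mul]
    have e1 : Complex.exp (((2 : ℕ) : ℂ) * (I * ((t - π) / 4 : ℝ))) = - I * Complex.exp (t / 2 * I) := by
      rw [show ((2 : ℕ) : ℂ) * (I * ((t - π) / 4 : ℝ)) = t / 2 * I + (-(π / 2 * I)) by push_cast; ring,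
        Complex.exp_add, Complex.exp_neg, Complex.exp_pi_div_two_mul_I]
      simp [mul_comm]
    rw [e1, Complex.sin, show I * (t : ℂ) = t / 2 * I + t / 2 * I by ring, Complex.exp_add]
    have e2 : Complex.exp (-(t / 2 : ℂ) * I) * Complex.exp (t / 2 * I) = 1 := by
      rw [← Complex.exp_add]; simp
    linear_combination (-1 : ℂ) * e2 + (Complex.exp (-(t / 2 : ℂ) * I) * Complex.exp (t / 2 * I) - Complex.exp (t / 2 * I) ^ 2) * Complex.I_sq
  have h2 : uu t = x * ex t := by
    unfold uu Uf
    rw [h1]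
    apply Complex.sq_cpow_two_inv
    rw [Complex.re_ofReal_mul]
    apply mul_pos hxp
    unfold ex
    rw [mul_comm, Complex.exp_ofReal_mul_I_re]
    apply Real.cos_pos_of_mem_Ioo
    constructor <;> linarith
  unfold xc
  rw [h2]
  linear_combination (x : ℂ) * ex_star t

def bb (t : ℝ) : ℂ := 2 * uu t * (vv t + 1)⁻¹ + 4 * uu t * vv t - 4 - 4 * uu t ^ 2

lemma vv_one_lower (t : ℝ) : 1 ≤ ‖vv t + 1‖ := by
  refine le_trans ?_ (Complex.re_le_norm _)
  have := Vf_re_lower (ee_re_le t)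
  simp [vv]; linarith

lemma bb_nice : Nice bb :=
  (((((Nice.const 2).mul uu_nice).mul
    ((vv_nice.add (Nice.const 1)).inv zero_lt_one (fun t _ _ => vv_one_lower t))).add
    (((Nice.const 4).mul uu_nice).mul vv_nice)).sub (Nice.const 4)).sub ((Nice.const 4).mul (uu_nice.pow 2))

def cc (t : ℝ) : ℂ := (ex t + star (ex t)) * 2⁻¹
def kk (t : ℝ) : ℂ := (ex t ^ 2 * bb t + star (ex t ^ 2 * bb t)) * 2⁻¹
def EE (t : ℝ) : ℂ := 2 * cc t + xc t * kk t

lemma cc_nice : Nice cc := (ex_nice.add ex_nice.star).mul (Nice.const _)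
lemma kk_nice : Nice kk :=
  (((ex_nice.pow 2).mul bb_nice).add ((ex_nice.pow 2).mul bb_nice).star).mul (Nice.const _)
lemma EE_nice : Nice EE := ((Nice.const 2).mul cc_nice).add (xc_nice.mul kk_nice)

lemma uu_sq (t : ℝ) : uu t ^ 2 = 1 - ee t := Uf_sq _
lemma vv_sq (t : ℝ) : vv t ^ 2 = 2 - ee t := Vf_sq _
lemma psi_uv (t : ℝ) : psiFn t = (vv t - uu t) ^ 2 := psi_eq t

lemma wpsi (t : ℝ) : 1 - wFn t * psiFn t = 2 * uu t + uu t ^ 2 * bb t := by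
  have hw : wFn t = 1 + 2 * uu t ^ 2 := by
    rw [uu_sq]; change 3 - 2 * ee t = _; ring
  have hne : vv t + 1 ≠ 0 := norm_pos_iff.1 (by linarith [vv_one_lower t])
  have hv : vv t ^ 2 = 1 + uu t ^ 2 := by rw [vv_sq, uu_sq]; ring
  have hb : bb t * (vv t + 1) = 2 * uu t + (4 * uu t * vv t - 4 - 4 * uu t ^ 2) * (vv t + 1) := by
    unfold bb; field_simp; ring
  have h2 : uu t ^ 2 * bb t = 2 * uu t * (vv t - 1) + uu t ^ 2 * (4 * uu t * vv t - 4 - 4 * uu t ^ 2) := by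
    apply mul_right_cancel₀ hne
    linear_combination uu t ^ 2 * hb - 2 * uu t * hv
  rw [h2, hw, psi_uv]
  linear_combination (-1 - 2 * uu t ^ 2) * hv

lemma phi_lower (t : ℝ) : ‖uu t‖ / 8 ≤ 1 - phiFn t := by
  have hw : wFn t = 1 + 2 * uu t ^ 2 := by
    rw [uu_sq]; change 3 - 2 * ee t = _; ring
  have hv : vv t ^ 2 = 1 + uu t ^ 2 := by rw [vv_sq, uu_sq]; ring
  have h1 : wFn t * psiFn t = (1 + psiFn t ^ 2) / 2 := by
    rw [hw, psi_uv]
    linear_combination (2⁻¹ * (vv t ^ 2 - uu t ^ 2 + 1) - (vv t - uu t) ^ 2) * hv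
  have h2 : phiFn t ≤ (1 + ‖Sf (ee t)‖) / 2 := by
    unfold phiFn
    rw [h1, psi_eq]
    have h3 : ((Sf (ee t) ^ 2) ^ 2).re ≤ ‖Sf (ee t)‖ := by
      refine (Complex.re_le_norm _).trans ?_
      rw [norm_pow, norm_pow, ← pow_mul]
      exact pow_le_of_le_one (norm_nonneg _) (Sf_norm_le_one (ee_re_le t)) (by norm_num)
    have : ((1 + (Sf (ee t) ^ 2) ^ 2) / 2).re = (1 + ((Sf (ee t) ^ 2) ^ 2).re) / 2 := by
      rw [show ((1 + (Sf (ee t) ^ 2) ^ 2) / 2 : ℂ) = ((2⁻¹ : ℝ) : ℂ) * (1 + (Sf (ee t) ^ 2) ^ 2) by push_cast; ring,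
        Complex.re_ofReal_mul]
      simp; ring
    rw [this]; linarith
  have h4 := Sf_norm_le (ee_re_le t)
  set y := √(‖1 - ee t‖ / 2) with hy
  have hy0 : 0 ≤ y := Real.sqrt_nonneg _
  have hy2 : y ^ 2 = ‖uu t‖ ^ 2 / 2 := by
    rw [hy, Real.sq_sqrt (by positivity)]; unfold uu; rw [Uf_norm_sq]
  have hy1 : y ≤ 1 := by
    rw [hy]; apply Real.sqrt_le_one.2
    have := norm_sub_le (1 : ℂ) (ee t)
    rw [ee_norm] at this
    simp at this; linarith
  have hyu : ‖uu t‖ / 2 ≤ y := by nlinarith [norm_nonneg (uu t)]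
  have : y / 2 ≤ 1 - ‖Sf (ee t)‖ := by
    nlinarith [norm_nonneg (Sf (ee t))]
  linarith

lemma uu_eq_xc {t : ℝ} : uu t = xc t * ex t := by
  unfold xc; linear_combination -uu t * ex_star t

lemma phi_eq {t : ℝ} (h0 : 0 < t) (ht : t ≤ π) : (1 - phiFn t : ℂ) = xc t * EE t := by
  obtain ⟨x, hx, hxc⟩ := xc_real h0 ht
  have h1 : ((1 - wFn t * psiFn t).re : ℂ) = (1 - phiFn t : ℂ) := by
    unfold phiFn; simp
  rw [← h1, Complex.re_eq_add_conj, wpsi, uu_eq_xc, hxc]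
  unfold EE kk cc
  rw [hxc]
  simp only [starRingEnd_apply]
  simp only [star_add, star_mul, star_pow]
  simp
  ring

lemma EE_lower {t : ℝ} (h0 : 0 < t) (ht : t ≤ π) : 1 / 8 ≤ ‖EE t‖ := by
  obtain ⟨x, hx, hxc⟩ := xc_real h0 ht
  have h1 := phi_lower t
  have h2 := phi_eq h0 ht
  have h3 : 1 - phiFn t ≤ x * ‖EE t‖ := by
    have := congrArg norm h2
    rw [norm_mul, hxc, Complex.norm_real, Real.norm_of_nonneg hx.le] at this
    rw [← this]
    refine (le_abs_self _).trans ?_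
    rw [← Real.norm_eq_abs, ← Complex.norm_real]; push_cast; rfl
  rw [uu_eq_xc, norm_mul, ex_norm, hxc, Complex.norm_real, Real.norm_of_nonneg hx.le] at h1
  have : x * (1 / 8) ≤ x * ‖EE t‖ := by linarith
  exact le_of_mul_le_mul_left this hx

lemma EE_inv_nice : Nice (fun t => (EE t)⁻¹) :=
  EE_nice.inv (c := 1 / 8) (by norm_num) (fun _ h0 ht => EE_lower h0 ht)

def H2 (t : ℝ) : ℂ := (-(xc t * 2⁻¹) - cc t * kk t) * (EE t)⁻¹

lemma H2_nice : Nice H2 :=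
  ((xc_nice.mul (Nice.const _)).neg.sub (cc_nice.mul kk_nice)).mul EE_inv_nice

lemma H2_eq {t : ℝ} (h0 : 0 < t) (ht : t ≤ π) :
    (1 - phiFn t : ℂ)⁻¹ - (((Uf (ee t))⁻¹.re : ℝ) : ℂ) = H2 t := by
  obtain ⟨x, hx, hxc⟩ := xc_real h0 ht
  have hx0 : (x : ℂ) ≠ 0 := by exact_mod_cast hx.ne'
  have hE : EE t ≠ 0 := norm_pos_iff.1 (lt_of_lt_of_le (by norm_num) (EE_lower h0 ht))
  have hex : ex t ≠ 0 := norm_pos_iff.1 (by rw [ex_norm]; norm_num)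
  have hinv : (Uf (ee t))⁻¹ = (x : ℂ)⁻¹ * star (ex t) := by
    change (uu t)⁻¹ = _
    rw [uu_eq_xc, hxc, mul_inv]
    congr 1
    field_simp
    linear_combination -ex_star t
  have h3 : (((Uf (ee t))⁻¹.re : ℝ) : ℂ) = cc t * (x : ℂ)⁻¹ := by
    rw [hinv, Complex.re_eq_add_conj]
    simp only [starRingEnd_apply]
    unfold cc
    simp
    ring
  rw [h3, phi_eq h0 ht, hxc]
  unfold H2
  rw [hxc]
  have hee : ee t = 1 - x ^ 2 * ex t ^ 2 := by
    have := uu_sq t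
    rw [uu_eq_xc, hxc] at this
    linear_combination this
  have h4 : ex t ^ 2 + star (ex t) ^ 2 = x ^ 2 := by
    have h5 := ee_star t
    rw [hee] at h5
    simp only [star_sub, star_mul, star_pow, star_one] at h5
    have h6 : star (x : ℂ) = x := by simp
    rw [h6] at h5
    have h7 : (x : ℂ) ^ 2 * (ex t ^ 2 + star (ex t) ^ 2) = x ^ 2 * x ^ 2 := by
      linear_combination (-1 : ℂ) * h5 + (x : ℂ) ^ 4 * (ex t * star (ex t) + 1) * ex_star t
    exact mul_left_cancel₀ (pow_ne_zero 2 hx0) h7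
  have h8 : 1 - 2 * cc t ^ 2 = -(x : ℂ) ^ 2 / 2 := by
    unfold cc
    linear_combination (-1 / 2 : ℂ) * h4 - ex_star t
  have h9 : EE t = 2 * cc t + x * kk t := by unfold EE; rw [hxc]
  field_simp
  rw [h9]
  linear_combination 2 * h8

def OneC (f : ℝ → ℂ) : Prop := ∃ g, Nice g ∧ ∀ t, 0 < t → t ≤ π → f t = 1 + xc t * g t

lemma OneC.mul {f g : ℝ → ℂ} (hf : OneC f) (hg : OneC g) : OneC (fun t => f t * g t) := by
  obtain ⟨a, ha, hf⟩ := hf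
  obtain ⟨b, hb, hg⟩ := hg
  refine ⟨fun t => a t + b t + xc t * (a t * b t), (ha.add hb).add (xc_nice.mul (ha.mul hb)), ?_⟩
  intro t h0 ht
  beta_reduce
  rw [hf t h0 ht, hg t h0 ht]; ring

lemma OneC.pow {f : ℝ → ℂ} (hf : OneC f) (n : ℕ) : OneC (fun t => f t ^ n) := by
  induction n with
  | zero => exact ⟨fun _ => 0, Nice.const 0, by simp⟩
  | succ n ih => simpa [pow_succ] using ih.mul hf

lemma ee_one : OneC ee := by
  refine ⟨fun t => -(ex t * uu t), (ex_nice.mul uu_nice).neg, fun t h0 ht => ?_⟩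
  have := uu_sq t
  rw [pow_two] at this
  nth_rw 1 [uu_eq_xc] at this
  linear_combination this

lemma ee_star_one : OneC (fun t => star (ee t)) := by
  refine ⟨fun t => star (ee t) * (ex t * uu t), ee_nice.star.mul (ex_nice.mul uu_nice),
    fun t h0 ht => ?_⟩
  have := uu_sq t
  rw [pow_two] at this
  nth_rw 1 [uu_eq_xc] at this
  linear_combination -star (ee t) * this + ee_star t

lemma psi_one : OneC psiFn := by
  refine ⟨fun t => 2 * (ex t * uu t) - 2 * (ex t * vv t),
    ((Nice.const 2).mul (ex_nice.mul uu_nice)).sub ((Nice.const 2).mul (ex_nice.mul vv_nice)),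
    fun t h0 ht => ?_⟩
  have hv : vv t ^ 2 = 1 + uu t ^ 2 := by rw [vv_sq, uu_sq]; ring
  rw [psi_uv]
  linear_combination hv + (2 * uu t - 2 * vv t) * (uu_eq_xc (t := t))

lemma psi_nice : Nice psiFn := by
  have := (vv_nice.sub uu_nice).pow 2
  convert this using 2 with t
  exact psi_uv t

lemma exp_one (m : ℤ) : OneC (fun t => Complex.exp (I * t * (m : ℂ))) := by
  rcases Int.eq_nat_or_neg m with ⟨k, rfl | rfl⟩
  · convert ee_one.pow k using 2 with t
    unfold ee; rw [← Complex.exp_nat_mul]; push_cast; ring_nf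
  · convert ee_star_one.pow k using 2 with t
    rw [← ee_neg]
    unfold ee; rw [← Complex.exp_nat_mul]; push_cast; ring_nf

lemma H1_exists (m : ℤ) (a : ℕ) : ∃ g, Nice g ∧ ∀ t, 0 < t → t ≤ π →
    (Complex.exp (I * t * (m : ℂ)) * psiFn t ^ a - 1) * (1 - phiFn t : ℂ)⁻¹ = g t := by
  obtain ⟨g, hg, h⟩ := (exp_one m).mul (psi_one.pow a)
  refine ⟨fun t => g t * (EE t)⁻¹, hg.mul EE_inv_nice, fun t h0 ht => ?_⟩
  obtain ⟨x, hx, hxc⟩ := xc_real h0 ht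
  have hx0 : (x : ℂ) ≠ 0 := by exact_mod_cast hx.ne'
  have hE : EE t ≠ 0 := norm_pos_iff.1 (lt_of_lt_of_le (by norm_num) (EE_lower h0 ht))
  have := h t h0 ht
  simp only at this
  rw [this, phi_eq h0 ht, hxc]
  field_simp
  ring


open MeasureTheory in
lemma osc_parts : ∃ M : ℝ, 0 ≤ M ∧ ∀ (A : ℝ) (F : ℝ → ℂ), 0 ≤ A →
    (∀ t, 0 < t → t ≤ π → ∃ d : ℂ, HasDerivAt F d t ∧ ‖F t‖ ≤ A ∧ ‖d‖ ≤ A * (√t)⁻¹) →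
    ∀ n : ℤ, |(n : ℝ)| * ‖∫ t in (0:ℝ)..π, Complex.exp (I * t * (n : ℂ)) * F t‖ ≤ A * M := by
  set J : ℝ := ∫ t in (0:ℝ)..π, (√t)⁻¹ with hJ
  have hJ0 : 0 ≤ J := intervalIntegral.integral_nonneg Real.pi_pos.le (fun t _ => by positivity)
  refine ⟨2 + J, by positivity, ?_⟩
  intro A F hA hF n
  have hd : ∀ t, 0 < t → t ≤ π → HasDerivAt F (deriv F t) t ∧ ‖F t‖ ≤ A ∧ ‖deriv F t‖ ≤ A * (√t)⁻¹ := by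
    intro t h0 ht
    obtain ⟨d, h1, h2, h3⟩ := hF t h0 ht
    rw [h1.deriv]; exact ⟨h1, h2, h3⟩
  have hmode : ∀ t : ℝ, ‖Complex.exp (I * t * (n : ℂ))‖ = 1 := fun t => mode_norm _ _ (by simp)
  have hcont : ContinuousOn F (Set.Ioc 0 π) := fun t ht =>
    (hd t ht.1 ht.2).1.continuousAt.continuousWithinAt
  have hIntg : IntervalIntegrable (fun t : ℝ => Complex.exp (I * t * (n : ℂ)) * F t) volume 0 π := by
    refine (intervalIntegrable_const (c := A)).mono_fun' ?_ ?_
    · rw [Set.uIoc_of_le Real.pi_pos.le]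
      exact ((mode_cont n).continuousOn.mul hcont).aestronglyMeasurable measurableSet_Ioc
    · rw [Set.uIoc_of_le Real.pi_pos.le]
      filter_upwards [ae_restrict_mem measurableSet_Ioc] with t ht
      rw [norm_mul, hmode, one_mul]
      exact (hd t ht.1 ht.2).2.1
  have key : ∀ ε, 0 < ε → ε ≤ π →
      |(n : ℝ)| * ‖∫ t in ε..π, Complex.exp (I * t * (n : ℂ)) * F t‖ ≤ A * (2 + J) := by
    intro ε he hep
    have hsub : Set.uIcc ε π ⊆ Set.uIcc 0 π := by
      rw [Set.uIcc_of_le hep, Set.uIcc_of_le Real.pi_pos.le]; exact Set.Icc_subset_Icc he.le le_rfl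
    have hi1 := hIntg.mono_set hsub
    have hi2 : IntervalIntegrable (fun t : ℝ => Complex.exp (I * t * (n : ℂ)) * deriv F t) volume ε π := by
      refine ((inv_sqrt_int_pos.mono_set hsub).const_mul A).mono_fun' ?_ ?_
      · exact ((mode_cont n).measurable.mul (measurable_deriv F)).aestronglyMeasurable
      · rw [Set.uIoc_of_le hep]
        filter_upwards [ae_restrict_mem measurableSet_Ioc] with t ht
        rw [norm_mul, hmode, one_mul]
        exact (hd t (he.trans ht.1) ht.2).2.2
    have hFT := intervalIntegral.integral_eq_sub_of_hasDerivAt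
      (f := fun t : ℝ => Complex.exp (I * t * (n : ℂ)) * F t)
      (f' := fun t : ℝ => (I * n) * (Complex.exp (I * t * (n : ℂ)) * F t) + Complex.exp (I * t * (n : ℂ)) * deriv F t)
      (a := ε) (b := π) (by
        intro t ht
        rw [Set.uIcc_of_le hep] at ht
        have h1 : HasDerivAt (fun t : ℝ => I * (t : ℂ) * (n : ℂ)) (I * n) t := by
          simpa using ((Complex.ofRealCLM.hasDerivAt (x := t)).const_mul I).mul_const (n : ℂ)
        have h2 := h1.cexp.mul (hd t (he.trans_le ht.1) ht.2).1
        refine h2.congr_deriv ?_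
        ring) ((hi1.const_mul _).add hi2)
    rw [intervalIntegral.integral_add (hi1.const_mul _) hi2, intervalIntegral.integral_const_mul] at hFT
    have h3 : ‖∫ t in ε..π, Complex.exp (I * t * (n : ℂ)) * deriv F t‖ ≤ A * J := by
      refine (intervalIntegral.norm_integral_le_of_norm_le hep (g := fun t => A * (√t)⁻¹) ?_
        ((inv_sqrt_int_pos.mono_set hsub).const_mul A)).trans ?_
      · filter_upwards with t ht
        rw [norm_mul, hmode, one_mul]
        exact (hd t (he.trans ht.1) ht.2).2.2
      · rw [intervalIntegral.integral_const_mul]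
        refine mul_le_mul_of_nonneg_left ?_ hA
        exact intervalIntegral.integral_mono_interval he.le hep le_rfl
          (Filter.Eventually.of_forall fun t => by positivity) inv_sqrt_int_pos
    have h4 : |(n : ℝ)| * ‖∫ t in ε..π, Complex.exp (I * t * (n : ℂ)) * F t‖ =
        ‖(I * n) * ∫ t in ε..π, Complex.exp (I * t * (n : ℂ)) * F t‖ := by
      rw [norm_mul, norm_mul, Complex.norm_I, one_mul, Complex.norm_intCast]
    rw [h4, eq_sub_of_add_eq hFT]
    refine (norm_sub_le _ _).trans ?_
    refine (add_le_add (norm_sub_le _ _) h3).trans ?_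
    rw [norm_mul, norm_mul, hmode, hmode]
    have a1 := (hd π Real.pi_pos le_rfl).2.1
    have a2 := (hd ε he hep).2.1
    linarith
  refine le_of_forall_pos_le_add fun δ hδ => ?_
  set ε : ℝ := min π (δ / (|(n : ℝ)| * A + 1)) with hε
  have he : 0 < ε := lt_min Real.pi_pos (by positivity)
  have hep : ε ≤ π := min_le_left _ _
  have h1 : ‖∫ t in (0:ℝ)..ε, Complex.exp (I * t * (n : ℂ)) * F t‖ ≤ A * ε := by
    have := intervalIntegral.norm_integral_le_of_norm_le_const (a := 0) (b := ε) (C := A)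
      (f := fun t : ℝ => Complex.exp (I * t * (n : ℂ)) * F t) (by
        intro t ht
        rw [Set.uIoc_of_le he.le] at ht
        rw [norm_mul, hmode, one_mul]
        exact (hd t ht.1 (ht.2.trans hep)).2.1)
    simpa [abs_of_pos he] using this
  have hsplit := intervalIntegral.integral_add_adjacent_intervals (a := 0) (b := ε) (c := π)
    (f := fun t : ℝ => Complex.exp (I * t * (n : ℂ)) * F t) (μ := volume)
    (hIntg.mono_set (by
      rw [Set.uIcc_of_le he.le, Set.uIcc_of_le Real.pi_pos.le]; exact Set.Icc_subset_Icc le_rfl hep))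
    (hIntg.mono_set (by
      rw [Set.uIcc_of_le hep, Set.uIcc_of_le Real.pi_pos.le]; exact Set.Icc_subset_Icc he.le le_rfl))
  rw [← hsplit]
  have h2 := key ε he hep
  have h3 : |(n : ℝ)| * (A * ε) ≤ δ := by
    have : ε ≤ δ / (|(n : ℝ)| * A + 1) := min_le_right _ _
    rw [le_div_iff₀ (by positivity)] at this
    nlinarith
  calc _ ≤ |(n : ℝ)| * (A * ε + ‖∫ t in ε..π, Complex.exp (I * t * (n : ℂ)) * F t‖) := by
        gcongr
        exact (norm_add_le _ _).trans (by gcongr)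
    _ ≤ _ := by rw [mul_add]; linarith

lemma psi_norm_le_one (t : ℝ) : ‖psiFn t‖ ≤ 1 := by
  rw [psi_eq, norm_pow]; exact pow_le_one₀ (norm_nonneg _) (Sf_norm_le_one (ee_re_le t))

lemma osc_n {h : ℝ → ℂ} (hh : Nice h) : ∃ C : ℝ, 0 ≤ C ∧ ∀ (n : ℤ) (k : ℕ),
    |(n : ℝ)| * ‖∫ t in (0:ℝ)..π, Complex.exp (I * t * (n : ℂ)) * (psiFn t ^ k * h t)‖ ≤ C * (k + 1) := by
  obtain ⟨M, hM, hosc⟩ := osc_parts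
  obtain ⟨C, hC, hh⟩ := hh
  obtain ⟨D, hD, hp⟩ := psi_nice
  refine ⟨(C + C * D) * M, by positivity, fun n k => ?_⟩
  refine (hosc ((C + C * D) * (k + 1)) (fun t => psiFn t ^ k * h t) (by positivity) ?_ n).trans (le_of_eq (by ring))
  intro t h0 ht
  obtain ⟨d, a1, a2, a3⟩ := hh t h0 ht
  obtain ⟨e, b1, b2, b3⟩ := hp t h0 ht
  have hpk : ∀ j : ℕ, ‖psiFn t ^ j‖ ≤ 1 := fun j => by
    rw [norm_pow]; exact pow_le_one₀ (norm_nonneg _) (psi_norm_le_one t)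
  refine ⟨_, (b1.fun_pow k).mul a1, ?_, ?_⟩
  · rw [norm_mul]
    have : ‖psiFn t ^ k‖ * ‖h t‖ ≤ 1 * C := by gcongr; exact hpk k
    have h3 : 0 ≤ C * k := by positivity
    have h4 : 0 ≤ C * D * (k + 1) := by positivity
    nlinarith
  · refine (norm_add_le _ _).trans ?_
    simp only [norm_mul]
    have h1 : ‖(k : ℂ)‖ * ‖psiFn t ^ (k - 1)‖ * ‖e‖ * ‖h t‖ ≤ k * 1 * (D * (√t)⁻¹) * C := by
      have := hpk (k - 1)
      rw [Complex.norm_natCast]; gcongr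
    have h2 : ‖psiFn t ^ k‖ * ‖d‖ ≤ 1 * (C * (√t)⁻¹) := by
      have := hpk k
      gcongr
    have h3 : 0 ≤ C * k * (√t)⁻¹ := by positivity
    have h4 : 0 ≤ C * D * (√t)⁻¹ := by positivity
    nlinarith

open MeasureTheory in
lemma osc_k {h : ℝ → ℂ} (hh : Nice h) : ∃ C : ℝ, 0 ≤ C ∧ ∀ (n : ℤ) (k : ℕ),
    ‖∫ t in (0:ℝ)..π, Complex.exp (I * t * (n : ℂ)) * (psiFn t ^ k * h t)‖ ≤
      C * ((k : ℝ) + 1) ^ (-(3 / 2) : ℝ) := by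
  obtain ⟨C, hC, hh⟩ := hh
  have hIntg : IntervalIntegrable (fun t : ℝ => t ^ (-(3 / 4) : ℝ)) volume 0 π :=
    intervalIntegral.intervalIntegrable_rpow' (by norm_num)
  set J : ℝ := ∫ t in (0:ℝ)..π, t ^ (-(3 / 4) : ℝ) with hJ
  have hJ0 : 0 ≤ J := intervalIntegral.integral_nonneg Real.pi_pos.le
    (fun t ht => Real.rpow_nonneg ht.1 _)
  refine ⟨C * π ^ (3 / 4 : ℝ) * J, by positivity, fun n k => ?_⟩
  set K : ℝ := (k : ℝ) + 1 with hK
  have hK0 : 0 < K := by positivity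
  refine (intervalIntegral.norm_integral_le_of_norm_le Real.pi_pos.le
    (g := fun t => (C * π ^ (3 / 4 : ℝ) * K ^ (-(3 / 2) : ℝ)) * t ^ (-(3 / 4) : ℝ)) ?_
    (hIntg.const_mul _)).trans ?_
  · filter_upwards with t ht
    obtain ⟨h0, ht⟩ := ht
    obtain ⟨d, a1, a2, a3⟩ := hh t h0 ht
    rw [norm_mul, mode_norm _ _ (by simp), one_mul, norm_mul, norm_pow, psi_eq, norm_pow]
    have hs := Sf_norm_le (ee_re_le t)
    have hl := norm_one_sub_ee_lower (t := t) (by rwa [abs_of_pos h0])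
    rw [abs_of_pos h0] at hl
    set s := √(t / π) with hsd
    have hs0 : 0 < s := Real.sqrt_pos.2 (by positivity)
    have hs1 : s ≤ 1 := by
      rw [hsd]; apply Real.sqrt_le_one.2; rw [div_le_one Real.pi_pos]; exact ht
    have hsy : s ≤ √(‖1 - ee t‖ / 2) := by
      apply Real.sqrt_le_sqrt
      have : t / π = 2 / π * t / 2 := by ring
      rw [this]; linarith
    set σ := ‖Sf (ee t)‖ with hσ
    have hσ0 : 0 ≤ σ := norm_nonneg _
    have h1 : σ * (1 + s) ≤ 1 := by nlinarith
    have h2 : σ ^ k * (K * s) ≤ 1 := by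
      have b := one_add_mul_le_pow (a := s) (by linarith) k
      have : K * s ≤ (1 + s) ^ k := by rw [hK]; nlinarith
      calc σ ^ k * (K * s) ≤ σ ^ k * (1 + s) ^ k := by gcongr
        _ = (σ * (1 + s)) ^ k := by rw [mul_pow]
        _ ≤ 1 := pow_le_one₀ (by positivity) h1
    have hσk : σ ^ k ≤ 1 := pow_le_one₀ hσ0 (Sf_norm_le_one (ee_re_le t))
    have h3 : (σ ^ 2) ^ k ≤ (K * s) ^ (-(3 / 2) : ℝ) := by
      have hq : 0 ≤ σ ^ k := by positivity
      have h4 : σ ^ k ≤ (K * s)⁻¹ := by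
        rw [← one_div, le_div_iff₀ (by positivity)]; exact h2
      calc (σ ^ 2) ^ k = (σ ^ k) ^ (2 : ℝ) := by
            rw [Real.rpow_two, ← pow_mul, ← pow_mul, mul_comm]
        _ ≤ (σ ^ k) ^ (3 / 2 : ℝ) := Real.rpow_le_rpow_of_exponent_ge_of_imp hq hσk (by norm_num) (by norm_num)
        _ ≤ ((K * s)⁻¹) ^ (3 / 2 : ℝ) := Real.rpow_le_rpow hq h4 (by norm_num)
        _ = _ := by rw [Real.inv_rpow (by positivity), Real.rpow_neg (by positivity)]
    have h5 : (K * s) ^ (-(3 / 2) : ℝ) = K ^ (-(3 / 2) : ℝ) * (π ^ (3 / 4 : ℝ) * t ^ (-(3 / 4) : ℝ)) := by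
      rw [Real.mul_rpow hK0.le hs0.le, hsd, Real.sqrt_eq_rpow, ← Real.rpow_mul (by positivity),
        Real.div_rpow h0.le Real.pi_pos.le, show (1 / 2 * -(3 / 2) : ℝ) = -(3 / 4) by norm_num,
        Real.rpow_neg Real.pi_pos.le, div_inv_eq_mul, mul_comm (π ^ (3 / 4 : ℝ))]
    rw [h5] at h3
    calc (σ ^ 2) ^ k * ‖h t‖ ≤ (K ^ (-(3 / 2) : ℝ) * (π ^ (3 / 4 : ℝ) * t ^ (-(3 / 4) : ℝ))) * C := by gcongr
      _ = _ := by ring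
  · rw [intervalIntegral.integral_const_mul]
    exact le_of_eq (by ring)


lemma psi_neg (t : ℝ) : psiFn (-t) = star (psiFn t) := by
  rw [psi_eq, psi_eq, ee_neg]; unfold Sf
  rw [Uf_conj (ee_re_le t), Vf_conj (ee_re_le t)]; simp

lemma phi_neg (t : ℝ) : phiFn (-t) = phiFn t := by
  have hw : wFn (-t) = star (wFn t) := by
    change 3 - 2 * ee (-t) = star (3 - 2 * ee t)
    rw [ee_neg]; simp
  unfold phiFn
  rw [psi_neg, hw, ← star_mul', Complex.star_def, Complex.conj_re]

lemma mode_neg (t : ℝ) (n : ℤ) :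
    Complex.exp (I * ((-t : ℝ) : ℂ) * (n : ℂ)) = star (Complex.exp (I * t * (n : ℂ))) := by
  rw [Complex.star_def, ← Complex.exp_conj]; simp

open MeasureTheory in
lemma sym_bound {G g : ℝ → ℂ} (hG : IntervalIntegrable G volume (-π) π)
    (hs : ∀ t, G (-t) = star (G t)) (hg : ∀ t, 0 < t → t ≤ π → G t = g t) :
    ‖∫ t in (-π)..π, G t‖ ≤ 2 * ‖∫ t in (0:ℝ)..π, g t‖ := by
  have hp := Real.pi_pos
  have h1 : ∫ t in (0:ℝ)..π, G t = ∫ t in (0:ℝ)..π, g t := by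
    apply intervalIntegral.integral_congr_ae
    filter_upwards with t ht
    rw [Set.uIoc_of_le hp.le] at ht
    exact hg t ht.1 ht.2
  have h2 : ∫ t in (-π)..0, G t = star (∫ t in (0:ℝ)..π, G t) := by
    have := intervalIntegral.integral_comp_neg (a := 0) (b := π) G
    rw [neg_zero] at this
    rw [← this]
    simp only [hs, intervalIntegral.integral_of_le hp.le]
    exact integral_conj
  have hsplit := intervalIntegral.integral_add_adjacent_intervals (a := -π) (b := 0) (c := π) (μ := volume) (f := G)
    (hG.mono_set (by
      rw [Set.uIcc_of_le (by linarith), Set.uIcc_of_le (by linarith)]; exact Set.Icc_subset_Icc le_rfl hp.le))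
    (hG.mono_set (by
      rw [Set.uIcc_of_le (by linarith), Set.uIcc_of_le (by linarith)]; exact Set.Icc_subset_Icc (by linarith) le_rfl))
  rw [← hsplit, h2, h1]
  refine (norm_add_le _ _).trans ?_
  rw [norm_star]; linarith

lemma psi_meas : Measurable psiFn := by
  have : psiFn = fun t => Sf (ee t) ^ 2 := funext psi_eq
  rw [this]
  exact (Sf_meas.comp ee_cont.measurable).pow_const 2

lemma phi_meas : Measurable phiFn := by
  unfold phiFn
  refine Complex.measurable_re.comp (Measurable.mul ?_ psi_meas)
  have : Continuous wFn := by unfold wFn; fun_prop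
  exact this.measurable

open MeasureTheory in
lemma int_phi {q : ℝ → ℂ} (hq : Measurable q) (C : ℝ) (hb : ∀ t, ‖q t‖ ≤ C) :
    IntervalIntegrable (fun t => q t * (1 - phiFn t : ℂ)⁻¹) volume (-π) π := by
  have hC : 0 ≤ C := (norm_nonneg _).trans (hb 0)
  have hne : ∀ᵐ t : ℝ ∂volume, t ≠ 0 := by simp [ae_iff]
  refine (inv_sqrt_abs_int.const_mul (C * (8 * √π))).mono_fun' ?_ ?_
  · exact (hq.mul (measurable_const.sub (Complex.measurable_ofReal.comp phi_meas)).inv).aestronglyMeasurable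
  · filter_upwards [ae_restrict_of_ae hne, ae_restrict_mem measurableSet_uIoc] with t h0 ht
    have h := abs_le_of_uIoc ht
    have h1 := Uf_inv_bound h h0 zero_le_one le_rfl
    simp only [Complex.ofReal_one, one_mul] at h1
    have h2 := phi_lower t
    have h3 : 0 < ‖uu t‖ := norm_pos_iff.2 (Uf_ne (ee_ne_one h h0))
    have h4 : ‖(1 - phiFn t : ℂ)⁻¹‖ ≤ 8 * (√π * (√|t|)⁻¹) := by
      have : ‖(1 - phiFn t : ℂ)‖ = 1 - phiFn t := by
        rw [show (1 - phiFn t : ℂ) = ((1 - phiFn t : ℝ) : ℂ) by push_cast; rfl, Complex.norm_real,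
          Real.norm_of_nonneg (by linarith)]
      rw [norm_inv, this]
      calc (1 - phiFn t)⁻¹ ≤ (‖uu t‖ / 8)⁻¹ := by gcongr
        _ = 8 * ‖(Uf (ee t))⁻¹‖ := by rw [inv_div, norm_inv]; rfl
        _ ≤ _ := by gcongr
    rw [norm_mul]
    calc ‖q t‖ * ‖(1 - phiFn t : ℂ)⁻¹‖ ≤ C * (8 * (√π * (√|t|)⁻¹)) := by
          gcongr; exact hb t
      _ = _ := by ring

open MeasureTheory in
lemma int_U {q : ℝ → ℂ} (hq : Measurable q) (hb : ∀ t, ‖q t‖ ≤ 1) :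
    IntervalIntegrable (fun t => q t * (((Uf (ee t))⁻¹.re : ℝ) : ℂ)) volume (-π) π := by
  have hne : ∀ᵐ t : ℝ ∂volume, t ≠ 0 := by simp [ae_iff]
  refine (inv_sqrt_abs_int.const_mul (√π)).mono_fun' ?_ ?_
  · exact (hq.mul (Complex.measurable_ofReal.comp (Complex.measurable_re.comp
      (Uf_meas.comp ee_cont.measurable).inv))).aestronglyMeasurable
  · filter_upwards [ae_restrict_of_ae hne, ae_restrict_mem measurableSet_uIoc] with t h0 ht
    have h := abs_le_of_uIoc ht
    have h1 := Uf_inv_bound h h0 zero_le_one le_rfl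
    simp only [Complex.ofReal_one, one_mul] at h1
    rw [norm_mul, Complex.norm_real]
    calc ‖q t‖ * ‖(Uf (ee t))⁻¹.re‖ ≤ 1 * ‖(Uf (ee t))⁻¹‖ := by
          gcongr
          · exact hb t
          · exact Complex.abs_re_le_norm _
      _ ≤ _ := by rw [one_mul]; exact h1

def DD (n : ℤ) (k : ℕ) : ℂ := ∫ t in (-π)..π,
  Complex.exp (I * t * (n : ℂ)) * psiFn t ^ k / (1 - (phiFn t : ℂ))

def NN (m : ℤ) (a : ℕ) (n : ℤ) (k : ℕ) : ℂ := ∫ t in (-π)..π,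
  Complex.exp (I * t * ((n : ℂ) - (m : ℂ))) * psiFn t ^ (k + a) / (1 - (phiFn t : ℂ))

lemma q_meas (n : ℂ) (k : ℕ) : Measurable (fun t : ℝ => Complex.exp (I * t * n) * psiFn t ^ k) :=
  (mode_cont n).measurable.mul (psi_meas.pow_const k)

lemma q_bdd (n : ℂ) (hn : n.im = 0) (k : ℕ) (t : ℝ) : ‖Complex.exp (I * t * n) * psiFn t ^ k‖ ≤ 1 := by
  rw [norm_mul, mode_norm _ _ hn, one_mul, norm_pow]
  exact pow_le_one₀ (norm_nonneg _) (psi_norm_le_one t)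

lemma ND_bound (m : ℤ) (a : ℕ) : ∃ g, Nice g ∧ ∀ n k, ‖NN m a n k - DD n k‖ ≤
    2 * ‖∫ t in (0:ℝ)..π, Complex.exp (I * t * (n : ℂ)) * (psiFn t ^ k * g t)‖ := by
  obtain ⟨g, hg, h⟩ := H1_exists (-m) a
  refine ⟨g, hg, fun n k => ?_⟩
  have i1 := int_phi (q_meas ((n : ℂ) - m) (k + a)) 1 (q_bdd _ (by simp) _)
  have i2 := int_phi (q_meas (n : ℂ) k) 1 (q_bdd _ (by simp) _)
  unfold NN DD
  simp only [div_eq_mul_inv]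
  rw [← intervalIntegral.integral_sub i1 i2]
  refine sym_bound (i1.sub i2) ?_ ?_
  · intro t
    have e := mode_neg t (n - m)
    push_cast at e
    have e2 := mode_neg t n
    push_cast at e2
    simp only [Complex.ofReal_neg]
    rw [e, e2, psi_neg, phi_neg]
    simp
  · intro t h0 ht
    rw [← h t h0 ht]
    have : Complex.exp (I * t * ((n : ℂ) - m)) = Complex.exp (I * t * n) * Complex.exp (I * t * ((-m : ℤ) : ℂ)) := by
      rw [← Complex.exp_add]; push_cast; ring_nf
    rw [this, pow_add]; ring

lemma DM_bound : ∀ n k, ‖DD n k - MM n k‖ ≤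
    2 * ‖∫ t in (0:ℝ)..π, Complex.exp (I * t * (n : ℂ)) * (psiFn t ^ k * H2 t)‖ := by
  intro n k
  have i2 := int_phi (q_meas (n : ℂ) k) 1 (q_bdd _ (by simp) _)
  have i1 := int_U (q_meas (n : ℂ) k) (q_bdd _ (by simp) _)
  have hM : MM n k = ∫ t in (-π)..π, Complex.exp (I * t * (n : ℂ)) * psiFn t ^ k * (((Uf (ee t))⁻¹.re : ℝ) : ℂ) := by
    unfold MM
    simp only [psi_eq, ← pow_mul]
  rw [hM]
  unfold DD
  simp only [div_eq_mul_inv]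
  rw [← intervalIntegral.integral_sub i2 i1]
  refine sym_bound (i2.sub i1) ?_ ?_
  · intro t
    have e2 := mode_neg t n
    push_cast at e2
    simp only [Complex.ofReal_neg]
    rw [e2, psi_neg, phi_neg, ee_neg, Uf_conj (ee_re_le t)]
    have : ((star (Uf (ee t)))⁻¹).re = ((Uf (ee t))⁻¹).re := by
      rw [← star_inv₀, Complex.star_def, Complex.conj_re]
    rw [this]
    simp
  · intro t h0 ht
    rw [← H2_eq h0 ht]
    ring

lemma asym_aux {a C K N : ℝ} (ha : 0 ≤ a) (hC : 0 ≤ C) (hK : 1 ≤ K) (hN : 0 ≤ N)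
    (h1 : a ^ 2 * K ^ 3 ≤ C ^ 2) (h2 : N * a ≤ C * K) :
    a ^ 20 * (K ^ 2 + N) ^ 12 ≤ 2 ^ 12 * C ^ 20 := by
  have hK0 : 0 < K := by linarith
  rcases le_total (N ^ 2) (K ^ 5) with h | h
  · have hR : (K ^ 2 + N) ^ 2 ≤ 4 * K ^ 5 := by
      have : K ^ 4 ≤ K ^ 5 := pow_le_pow_right₀ hK (by norm_num)
      nlinarith [sq_nonneg (K ^ 2 - N)]
    calc a ^ 20 * (K ^ 2 + N) ^ 12 = a ^ 20 * ((K ^ 2 + N) ^ 2) ^ 6 := by ring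
      _ ≤ a ^ 20 * (4 * K ^ 5) ^ 6 := by gcongr
      _ = 2 ^ 12 * (a ^ 2 * K ^ 3) ^ 10 := by ring
      _ ≤ 2 ^ 12 * (C ^ 2) ^ 10 := by gcongr
      _ = _ := by ring
  · have hN1 : K ^ 2 ≤ N := by
      have : K ^ 4 ≤ K ^ 5 := pow_le_pow_right₀ hK (by norm_num)
      have h3 : (K ^ 2) ^ 2 ≤ N ^ 2 := by nlinarith
      exact (sq_le_sq₀ (by positivity) hN).1 h3
    have hN0 : 0 < N := by nlinarith
    have h4 : a ^ 20 * N ^ 12 ≤ C ^ 20 := by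
      have h5 : (N * a) ^ 20 ≤ (C * K) ^ 20 := by gcongr
      have h6 : a ^ 20 * N ^ 12 * N ^ 8 ≤ C ^ 20 * N ^ 8 := by
        calc a ^ 20 * N ^ 12 * N ^ 8 = (N * a) ^ 20 := by ring
          _ ≤ (C * K) ^ 20 := h5
          _ = C ^ 20 * (K ^ 5) ^ 4 := by ring
          _ ≤ C ^ 20 * (N ^ 2) ^ 4 := by gcongr
          _ = _ := by ring
      exact le_of_mul_le_mul_right h6 (by positivity)
    calc a ^ 20 * (K ^ 2 + N) ^ 12 ≤ a ^ 20 * (2 * N) ^ 12 := by gcongr; linarith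
      _ = 2 ^ 12 * (a ^ 20 * N ^ 12) := by ring
      _ ≤ _ := by gcongr

abbrev FF : Filter (ℤ × ℤ) := Filter.comap (fun y : ℤ × ℤ => |y.1| + |y.2|) Filter.atTop

lemma asym {e : ℤ → ℕ → ℂ} {g : ℝ → ℂ} (hg : Nice g) (he : ∀ n k, ‖e n k‖ ≤
    2 * ‖∫ t in (0:ℝ)..π, Complex.exp (I * t * (n : ℂ)) * (psiFn t ^ k * g t)‖) :
    Tendsto (fun y : ℤ × ℤ => ‖e y.1 y.2.natAbs‖ * √((y.2.natAbs : ℝ) ^ 2 + 1 + y.1.natAbs)) FF (nhds 0) := by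
  obtain ⟨C1, hC1, h1⟩ := osc_k hg
  obtain ⟨C2, hC2, h2⟩ := osc_n hg
  set C := 2 * (C1 + C2) with hC
  have hC0 : 0 ≤ C := by positivity
  set R : ℤ × ℤ → ℝ := fun y => ((y.2.natAbs : ℝ) + 1) ^ 2 + y.1.natAbs with hR
  have hR0 : ∀ y, 0 < R y := fun y => by simp only [hR]; positivity
  have key : ∀ y : ℤ × ℤ, (‖e y.1 y.2.natAbs‖ * √(R y)) ^ 20 ≤ 2 ^ 12 * C ^ 20 * (R y)⁻¹ := by
    intro y
    set a := ‖e y.1 y.2.natAbs‖ with ha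
    set K : ℝ := (y.2.natAbs : ℝ) + 1 with hK
    have hK1 : 1 ≤ K := by rw [hK]; linarith [(Nat.cast_nonneg y.2.natAbs : (0:ℝ) ≤ _)]
    have b0 := he y.1 y.2.natAbs
    have b1 := h1 y.1 y.2.natAbs
    have b2 := h2 y.1 y.2.natAbs
    have c1 : a ≤ C * K ^ (-(3 / 2) : ℝ) := by
      have : 0 ≤ K ^ (-(3 / 2) : ℝ) := by positivity
      rw [hC]; nlinarith
    have c2 : (y.1.natAbs : ℝ) * a ≤ C * K := by
      have e1 : (y.1.natAbs : ℝ) = |(y.1 : ℝ)| := by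
        rw [← Int.cast_abs, ← Int.natCast_natAbs]; simp
      rw [e1, hC]
      have := mul_le_mul_of_nonneg_left b0 (abs_nonneg (y.1 : ℝ))
      nlinarith
    have c3 : a ^ 2 * K ^ 3 ≤ C ^ 2 := by
      calc a ^ 2 * K ^ 3 ≤ (C * K ^ (-(3 / 2) : ℝ)) ^ 2 * K ^ 3 := by gcongr
        _ = C ^ 2 * ((K ^ (-(3 / 2) : ℝ)) ^ (2 : ℕ) * K ^ (3 : ℕ)) := by ring
        _ = C ^ 2 := by
          have hz : (K ^ (-(3 / 2) : ℝ)) ^ (2 : ℕ) * K ^ (3 : ℕ) = 1 := by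
            rw [← Real.rpow_natCast (K ^ (-(3 / 2) : ℝ)), ← Real.rpow_mul (by linarith),
              ← Real.rpow_natCast K, ← Real.rpow_add (by linarith)]
            norm_num
          rw [hz, mul_one]
    have c4 := asym_aux (norm_nonneg _) hC0 hK1 (Nat.cast_nonneg y.1.natAbs) c3 c2
    change a ^ 20 * (R y) ^ 12 ≤ _ at c4
    have hr := hR0 y
    have hr1 : 1 ≤ R y := by
      change 1 ≤ K ^ 2 + _
      nlinarith [(Nat.cast_nonneg y.1.natAbs : (0:ℝ) ≤ _)]
    rw [← div_eq_mul_inv, le_div_iff₀ hr]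
    calc (a * √(R y)) ^ 20 * R y = a ^ 20 * ((√(R y)) ^ 2) ^ 10 * R y := by ring
      _ = a ^ 20 * (R y) ^ 11 := by rw [Real.sq_sqrt hr.le]; ring
      _ ≤ a ^ 20 * (R y) ^ 12 := by gcongr; norm_num
      _ ≤ _ := c4
  have hRt : Tendsto R FF atTop := by
    have h0 : Tendsto (fun y : ℤ × ℤ => ((|y.1| + |y.2| : ℤ) : ℝ)) FF atTop :=
      tendsto_intCast_atTop_atTop.comp tendsto_comap
    refine tendsto_atTop_mono (fun y => ?_) h0
    simp only [hR]
    have e1 : ∀ z : ℤ, ((z.natAbs : ℕ) : ℝ) = ((|z| : ℤ) : ℝ) := fun z => by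
      rw [← Int.natCast_natAbs]; simp
    rw [e1, e1]; push_cast
    nlinarith [abs_nonneg (y.2 : ℝ), abs_nonneg (y.1 : ℝ)]
  have h20 : Tendsto (fun y => 2 ^ 12 * C ^ 20 * (R y)⁻¹) FF (nhds 0) := by
    simpa using (tendsto_inv_atTop_zero.comp hRt).const_mul (2 ^ 12 * C ^ 20)
  rw [Metric.tendsto_nhds]
  intro ε hε
  filter_upwards [h20.eventually (gt_mem_nhds (show 0 < ε ^ 20 by positivity))] with y hy
  have h5 : ‖e y.1 y.2.natAbs‖ * √(R y) < ε := 
    lt_of_pow_lt_pow_left₀ 20 hε.le ((key y).trans_lt hy)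
  rw [Real.dist_eq, sub_zero, abs_of_nonneg (by positivity)]
  refine lt_of_le_of_lt ?_ h5
  gcongr
  simp only [hR]
  nlinarith [(Nat.cast_nonneg y.2.natAbs : (0:ℝ) ≤ _)]

theorem main_aux (x : ℤ × ℤ) :
    Tendsto (fun y : ℤ × ℤ => NN x.1 x.2.natAbs y.1 y.2.natAbs / DD y.1 y.2.natAbs) FF (nhds 1) := by
  obtain ⟨g, hg, h⟩ := ND_bound x.1 x.2.natAbs
  have t1 := asym (e := fun n k => NN x.1 x.2.natAbs n k - DD n k) hg h
  have t2 := asym (e := fun n k => DD n k - MM n k) H2_nice DM_bound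
  rw [tendsto_iff_norm_sub_tendsto_zero]
  have t3 := t1.const_mul 200
  rw [mul_zero] at t3
  refine tendsto_of_tendsto_of_tendsto_of_le_of_le' tendsto_const_nhds t3 
    (Eventually.of_forall fun y => norm_nonneg _) ?_
  filter_upwards [t2.eventually (gt_mem_nhds (show (0:ℝ) < 1 / 200 by norm_num))] with y hy
  have hm := MM_lower y.1 y.2.natAbs
  set s := √((y.2.natAbs : ℝ) ^ 2 + 1 + y.1.natAbs) with hs
  have hs0 : 0 < s := Real.sqrt_pos.2 (by positivity)
  rw [div_le_iff₀ hs0] at hm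
  set D := DD y.1 y.2.natAbs
  set M := MM y.1 y.2.natAbs
  set N := NN x.1 x.2.natAbs y.1 y.2.natAbs
  have h1 : ‖M‖ ≤ ‖D‖ + ‖D - M‖ := by
    have := norm_sub_le D (D - M)
    simpa using this
  have h2 : 1 / 200 ≤ ‖D‖ * s := by nlinarith
  have hD : 0 < ‖D‖ := by
    by_contra hcon
    have : ‖D‖ = 0 := le_antisymm (not_lt.1 hcon) (norm_nonneg _)
    rw [this] at h2; norm_num at h2
  have hD0 : D ≠ 0 := norm_pos_iff.1 hD
  have h3 : N / D - 1 = (N - D) / D := by field_simp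
  rw [h3, norm_div, div_le_iff₀ hD]
  have := norm_nonneg (N - D)
  nlinarith

/-- For fixed `x = (x₁,x₂)`, the ratio
`[∫ e^{it(y₁-x₁)} ψ(t)^{|y₂|+|x₂|}/(1-φ(t)) dt] / [∫ e^{ity₁} ψ(t)^{|y₂|}/(1-φ(t)) dt]`
(which equals `∑_z ν_x(z) K(z,y)`) tends to `1` as `|y₁| + |y₂| → ∞`. -/
theorem averaged_martin_kernel_tendsto_one (x : ℤ × ℤ) :
    Tendsto (fun y : ℤ × ℤ =>
        (∫ t in (-Real.pi)..Real.pi,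
            Complex.exp (Complex.I * t * ((y.1 : ℂ) - (x.1 : ℂ))) *
              psiFn t ^ (y.2.natAbs + x.2.natAbs) / (1 - (phiFn t : ℂ))) /
        (∫ t in (-Real.pi)..Real.pi,
            Complex.exp (Complex.I * t * (y.1 : ℂ)) *
              psiFn t ^ y.2.natAbs / (1 - (phiFn t : ℂ))))
      (Filter.comap (fun y : ℤ × ℤ => |y.1| + |y.2|) Filter.atTop) (nhds 1) := by
  exact main_aux x
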